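/- arXiv:2302.03999 — 6 statements merged into one kernel-verified Lean document; each statement's English description precedes it below -/
import Mathlib

section
/- The infinite lower-triangular matrix T = (t_{n,k})_{n,k≥0} with integer entries t_{n,k} = binom(n,k)·n^{n-k} for 0 ≤ k ≤ n (with the convention 0^0 = 1) and t_{n,k} = 0 for k > n is totally positive: every minor of T is a nonnegative integer. -/
/-- The lower-triangular matrix `T` with entries `t_{n,k} = C(n,k) · n^{n-k}`
for `0 ≤ k ≤ n` (with `0^0 = 1`), and `t_{n,k} = 0` for `k > n`. -/
def treeMatrix (n k : ℕ) : ℤ :=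
  if k ≤ n then (n.choose k : ℤ) * (n : ℤ) ^ (n - k) else 0

open Matrix Finset

/-- All minors of `M` with row indices below `N` are nonnegative. -/
def MinorsNonnegBelow (N : ℕ) (M : ℕ → ℕ → ℤ) : Prop :=
  ∀ (k : ℕ) (r c : Fin k → ℕ), StrictMono r → StrictMono c → (∀ i, r i < N) →
    0 ≤ (Matrix.of fun a b => M (r a) (c b)).det

/-- The block-diagonal sum `1 ⊕ M`. -/
def oneSum (M : ℕ → ℕ → ℤ) : ℕ → ℕ → ℤ
  | 0, 0 => 1
  | 0, _ + 1 => 0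
  | _ + 1, 0 => 0
  | n + 1, k + 1 => M n k

/-- A symmetrized form of the Cauchy–Binet formula. -/
theorem factorial_mul_det_mul {R : Type*} [CommRing R] {k N : ℕ}
    (A : Matrix (Fin k) (Fin N) R) (B : Matrix (Fin N) (Fin k) R) :
    (k.factorial : R) * (A * B).det =
      ∑ f : Fin k → Fin N, (A.submatrix id f).det * (B.submatrix f id).det := by
  have expand : (A * B).det =
      ∑ f : Fin k → Fin N, (∏ i, A i (f i)) * (B.submatrix f id).det := by
    have h := (detRowAlternating (R := R) (n := Fin k)).toMultilinearMap.map_sum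
      (fun i (j : Fin N) => A i j • B j)
    have e : (A * B : Matrix (Fin k) (Fin k) R) = fun i => ∑ j, A i j • B j := by
      ext i j
      simp [Matrix.mul_apply]
    rw [Matrix.det, e]
    refine h.trans (sum_congr rfl fun f _ => ?_)
    exact MultilinearMap.map_smul_univ _ (fun i => A i (f i)) (fun i => B (f i))
  have perm (σ : Equiv.Perm (Fin k)) : (A * B).det =
      ∑ f : Fin k → Fin N,
        ((Equiv.Perm.sign σ : ℤ) : R) * (∏ i, A i (f (σ i))) * (B.submatrix f id).det := by
    rw [expand]
    refine Fintype.sum_equiv (σ.arrowCongr (Equiv.refl (Fin N))) _ _ fun f => ?_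
    have h := Matrix.det_permute σ (B.submatrix (f ∘ σ.symm) id)
    simp only [submatrix_submatrix, Function.comp_assoc, Equiv.symm_comp_self,
      Function.comp_id] at h
    simp only [Equiv.arrowCongr_apply, Equiv.coe_refl, id_eq,
      Function.comp_apply, Equiv.symm_apply_apply]
    rw [h]
    ring_nf
    rfl
  have e : (k.factorial : R) * (A * B).det = ∑ _σ : Equiv.Perm (Fin k), (A * B).det := by
    simp [Fintype.card_perm]
  rw [e, sum_congr rfl fun σ _ => perm σ, sum_comm]
  refine sum_congr rfl fun f _ => ?_
  rw [← sum_mul, ← det_transpose (A.submatrix id f), det_apply' (A.submatrix id f)ᵀ]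
  rfl

theorem det_mul_nonneg_of_minors {k N : ℕ}
    (A : Matrix (Fin k) (Fin N) ℤ) (B : Matrix (Fin N) (Fin k) ℤ)
    (hA : ∀ f : Fin k → Fin N, StrictMono f → 0 ≤ (A.submatrix id f).det)
    (hB : ∀ f : Fin k → Fin N, StrictMono f → 0 ≤ (B.submatrix f id).det) :
    0 ≤ (A * B).det := by
  have hk : (0 : ℤ) < k.factorial := by exact_mod_cast k.factorial_pos
  refine nonneg_of_mul_nonneg_right ?_ hk
  rw [factorial_mul_det_mul]
  refine sum_nonneg fun f _ => ?_
  by_cases hf : Function.Injective f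
  · have hs : StrictMono (f ∘ Tuple.sort f) :=
      (Tuple.monotone_sort f).strictMono_of_injective (hf.comp (Tuple.sort f).injective)
    have h := mul_nonneg (hA _ hs) (hB _ hs)
    have h1 := det_permute' (Tuple.sort f) (A.submatrix id f)
    have h2 := det_permute (Tuple.sort f) (B.submatrix f id)
    simp only [submatrix_submatrix, Function.comp_id] at h1 h2
    rw [h1, h2, mul_mul_mul_comm] at h
    simpa [← Units.val_mul] using h
  · obtain ⟨i, j, hij, hne⟩ := Function.not_injective_iff.1 hf
    rw [det_zero_of_row_eq (M := B.submatrix f id) hne (by ext; simp [hij]), mul_zero]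

namespace MinorsNonnegBelow

variable {N : ℕ} {M : ℕ → ℕ → ℤ}

theorem mul {A B : ℕ → ℕ → ℤ} (hA : MinorsNonnegBelow N A) (hB : MinorsNonnegBelow N B)
    (hM : ∀ i < N, ∀ j, M i j = ∑ m ∈ range N, A i m * B m j) : MinorsNonnegBelow N M := by
  intro k r c hr hc hlt
  have e : (Matrix.of fun a b => M (r a) (c b)) =
      (Matrix.of fun a (m : Fin N) => A (r a) m) * (Matrix.of fun (m : Fin N) b => B m (c b)) := by
    ext a b
    simp [Matrix.mul_apply, hM _ (hlt a), sum_range]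
  rw [e]
  exact det_mul_nonneg_of_minors _ _
    (fun f hf => hA k r (fun i => f i) hr (fun _ _ h => hf h) hlt)
    (fun f hf => hB k (fun i => f i) c (fun _ _ h => hf h) hc fun i => (f i).2)

theorem mul_bidiagonal (h : MinorsNonnegBelow N M) {w : ℕ → ℤ} (hw : ∀ j, 0 ≤ w j) :
    MinorsNonnegBelow N fun i j => M i j + w j * M i (j + 1) := by
  intro k r c hr hc hlt
  rw [← det_transpose]
  have hadd := (detRowAlternating (R := ℤ) (n := Fin k)).toMultilinearMap.map_add_univ
    (fun b a => M (r a) (c b)) (fun b a => w (c b) * M (r a) (c b + 1))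
  refine le_of_le_of_eq (sum_nonneg fun s _ => ?_) hadd.symm
  have e : (s.piecewise (fun b a => M (r a) (c b)) fun b a => w (c b) * M (r a) (c b + 1)) =
      Matrix.of fun b a => (if b ∈ s then 1 else w (c b)) *
        (Matrix.of fun b a => M (r a) (c b + if b ∈ s then 0 else 1)) b a := by
    ext b a
    by_cases hb : b ∈ s <;> simp [hb]
  rw [e]
  refine le_of_le_of_eq ?_ (det_mul_column _ _).symm
  refine mul_nonneg (prod_nonneg fun b _ => by split_ifs <;> simp [hw]) ?_
  have hmono : Monotone fun b => c b + if b ∈ s then 0 else 1 := by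
    intro a b hab
    rcases hab.eq_or_lt with rfl | hab
    · exact le_rfl
    · have := hc hab
      dsimp only
      split_ifs <;> omega
  by_cases hinj : Function.Injective fun b => c b + if b ∈ s then 0 else 1
  · rw [← det_transpose]
    exact h k r _ hr (hmono.strictMono_of_injective hinj) hlt
  · obtain ⟨i, j, hij, hne⟩ := Function.not_injective_iff.1 hinj
    refine (det_zero_of_row_eq hne ?_).ge
    ext a
    simp only [of_apply]
    exact congrArg (M (r a)) hij

theorem of_mul_eq_mul (h : MinorsNonnegBelow N M) {M' : ℕ → ℕ → ℤ} {u v : ℕ → ℤ}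
    (hu : ∀ i, 0 ≤ u i) (hv : ∀ j, 0 < v j) (hM : ∀ i j, v j * M' i j = u i * M i j) :
    MinorsNonnegBelow N M' := by
  intro k r c hr hc hlt
  refine nonneg_of_mul_nonneg_right ?_ (prod_pos fun j (_ : j ∈ univ) => hv (c j))
  rw [← det_mul_row]
  simp only [of_apply, hM]
  exact le_of_le_of_eq (mul_nonneg (prod_nonneg fun i _ => hu (r i)) (h k r c hr hc hlt))
    (det_mul_column (fun i => u (r i)) (of fun a b => M (r a) (c b))).symm

theorem oneSum (h : MinorsNonnegBelow N M) : MinorsNonnegBelow (N + 1) (oneSum M) := by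
  have pos {k : ℕ} (r c : Fin k → ℕ) (hr : StrictMono r) (hc : StrictMono c)
      (hlt : ∀ i, r i < N + 1) (hr0 : ∀ i, 0 < r i) (hc0 : ∀ i, 0 < c i) :
      0 ≤ (Matrix.of fun a b => _root_.oneSum M (r a) (c b)).det := by
    have hd := h k (fun i => r i - 1) (fun i => c i - 1)
      (fun a b hab => by have := hr hab; have := hr0 a; dsimp only; omega)
      (fun a b hab => by have := hc hab; have := hc0 a; dsimp only; omega)
      (fun i => by have := hlt i; have := hr0 i; omega)
    refine hd.trans_eq (congrArg det ?_)
    ext a b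
    obtain ⟨x, hx⟩ := Nat.exists_eq_succ_of_ne_zero (hr0 a).ne'
    obtain ⟨y, hy⟩ := Nat.exists_eq_succ_of_ne_zero (hc0 b).ne'
    simp [hx, hy, _root_.oneSum]
  have tail_pos {k : ℕ} (r : Fin (k + 1) → ℕ) (hr : StrictMono r) (i : Fin k) : 0 < r i.succ :=
    (Nat.zero_le _).trans_lt (hr i.succ_pos)
  have row_zero (j : ℕ) (hj : 0 < j) : _root_.oneSum M 0 j = 0 := by
    cases j with
    | zero => omega
    | succ j => rfl
  have column_zero (i : ℕ) (hi : 0 < i) : _root_.oneSum M i 0 = 0 := by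
    cases i with
    | zero => omega
    | succ i => rfl
  intro k r c hr hc hlt
  cases k with
  | zero => simp
  | succ k =>
    have all_pos (r : Fin (k + 1) → ℕ) (hr : StrictMono r) (h0 : 0 < r 0) (i) : 0 < r i :=
      h0.trans_le (hr.monotone i.zero_le)
    rcases Nat.eq_zero_or_pos (r 0) with hr0 | hr0
    · rcases Nat.eq_zero_or_pos (c 0) with hc0 | hc0
      · have h00 : _root_.oneSum M 0 0 = 1 := rfl
        have tail := pos (fun i => r i.succ) (fun i => c i.succ)
          (fun _ _ h => hr (Fin.succ_lt_succ_iff.2 h)) (fun _ _ h => hc (Fin.succ_lt_succ_iff.2 h))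
          (fun i => hlt _) (tail_pos r hr) (tail_pos c hc)
        rw [det_succ_row_zero, Fin.sum_univ_succ, sum_eq_zero (s := univ) fun j _ => by
          simp [hr0, row_zero _ (tail_pos c hc j)]]
        simpa [hr0, hc0, h00, submatrix] using tail
      · refine (det_eq_zero_of_row_eq_zero 0 fun j => ?_).ge
        simp [hr0, row_zero _ (all_pos c hc hc0 j)]
    · rcases Nat.eq_zero_or_pos (c 0) with hc0 | hc0
      · refine (det_eq_zero_of_column_eq_zero 0 fun i => ?_).ge
        simp [hc0, column_zero _ (all_pos r hr hr0 i)]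
      · exact pos r c hr hc hlt (all_pos r hr hr0) (all_pos c hc hc0)

theorem of_recurrence {w : ℕ → ℤ} (hw : ∀ j, 0 ≤ w j)
    (h0 : ∀ j, M 0 j = if j = 0 then 1 else 0) (hs0 : ∀ n, M (n + 1) 0 = w 0 * M n 0)
    (hs : ∀ n j, M (n + 1) (j + 1) = M n j + w (j + 1) * M n (j + 1)) (N : ℕ) :
    MinorsNonnegBelow N M := by
  induction N with
  | zero =>
    intro k r c _ _ hlt
    cases k with
    | zero => simp
    | succ k => exact absurd (hlt 0) (Nat.not_lt_zero _)
  | succ N ih =>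
    convert ih.oneSum.mul_bidiagonal hw using 3 with i j
    rcases i with _ | i <;> rcases j with _ | j <;> simp [h0, hs0, hs, _root_.oneSum]

end MinorsNonnegBelow

theorem minorsNonnegBelow_choose (N : ℕ) : MinorsNonnegBelow N fun n k => (n.choose k : ℤ) := by
  refine MinorsNonnegBelow.of_recurrence (w := fun _ => 1) (by simp) (fun j => ?_) (by simp)
    (fun n j => ?_) N
  · cases j <;> simp
  · simp [Nat.choose_succ_succ]

theorem minorsNonnegBelow_factorial_mul_choose (N : ℕ) :
    MinorsNonnegBelow N fun n k => ((n - k).factorial * n.choose k : ℤ) := by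
  have h : MinorsNonnegBelow N fun n k => if k ≤ n then 1 else 0 :=
    MinorsNonnegBelow.of_recurrence (w := fun j => if j = 0 then 1 else 0)
      (fun j => by split_ifs <;> simp) (by simp) (by simp) (by simp) N
  refine h.of_mul_eq_mul (u := fun i => (i.factorial : ℤ)) (v := fun j => (j.factorial : ℤ))
    (fun i => by positivity) (fun j => by positivity) fun i j => ?_
  split_ifs with hij
  · rw [← Nat.choose_mul_factorial_mul_factorial hij]
    push_cast
    ring
  · simp [Nat.choose_eq_zero_of_lt (not_le.1 hij)]

theorem treeMatrix_eq (n k : ℕ) : treeMatrix n k = (n.choose k : ℤ) * (n : ℤ) ^ (n - k) := by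
  unfold treeMatrix
  split_ifs with h
  · rfl
  · simp [Nat.choose_eq_zero_of_lt (not_le.1 h)]

theorem sum_treeMatrix_mul_choose {n N : ℕ} (hn : n < N) (k : ℕ) :
    (n.choose k : ℤ) * ((n : ℤ) + 1) ^ (n - k) =
      ∑ m ∈ range N, treeMatrix n m * (m.choose k : ℤ) := by
  have hsub : range (n + 1) ⊆ range N := range_subset_range.2 hn
  rw [← sum_subset hsub fun m _ hm => by
    simp [treeMatrix_eq, Nat.choose_eq_zero_of_lt (by simpa using hm : n < m)]]
  rcases lt_or_ge n k with hk | hk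
  · rw [Nat.choose_eq_zero_of_lt hk, sum_eq_zero]
    · simp
    · intro m hm
      rw [Nat.choose_eq_zero_of_lt (by simp at hm; omega : m < k)]
      simp
  · obtain ⟨d, rfl⟩ := Nat.exists_eq_add_of_le hk
    rw [add_assoc, sum_range_add, sum_eq_zero (s := range k), zero_add, add_comm ((_ : ℤ)) 1,
      add_pow, mul_sum, Nat.add_sub_cancel_left]
    · refine sum_congr rfl fun j hj => ?_
      have h := Nat.choose_mul (n := k + d) (k := k + j) (s := k) (by omega)
      rw [Nat.add_sub_cancel_left, Nat.add_sub_cancel_left] at h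
      have h' : ((k + d).choose (k + j) : ℤ) * ((k + j).choose k : ℤ) =
          (k + d).choose k * d.choose j := by exact_mod_cast h
      rw [treeMatrix_eq, Nat.add_sub_add_left, one_pow]
      linear_combination (-((k + d : ℕ) : ℤ) ^ (d - j)) * h'
    · intro m hm
      rw [Nat.choose_eq_zero_of_lt (by simpa using hm)]
      simp

/-- The matrix counting rooted forests on `n` labelled vertices with `k` components. -/
def forestMatrix : ℕ → ℕ → ℤ :=
  oneSum fun n k => (n.choose k : ℤ) * ((n : ℤ) + 1) ^ (n - k)

theorem forestMatrix_mul_factorial (n j : ℕ) :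
    forestMatrix n j * j.factorial = (n.descFactorial j : ℤ) * (n : ℤ) ^ (n - j) -
      (n.descFactorial (j + 1) : ℤ) * (n : ℤ) ^ (n - (j + 1)) := by
  rcases n with _ | n <;> rcases j with _ | m
  · simp [forestMatrix, oneSum]
  · simp [forestMatrix, oneSum]
  · simp [forestMatrix, oneSum, pow_succ']
  · have e : forestMatrix (n + 1) (m + 1) = (n.choose m : ℤ) * ((n : ℤ) + 1) ^ (n - m) := rfl
    rw [e, Nat.succ_descFactorial_succ, Nat.succ_descFactorial_succ, Nat.descFactorial_succ,
      Nat.descFactorial_eq_factorial_mul_choose, Nat.factorial_succ]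
    rcases lt_trichotomy n m with h | rfl | h
    · simp [Nat.choose_eq_zero_of_lt h]
    · simp
    · obtain ⟨d, rfl⟩ := Nat.exists_eq_add_of_lt h
      rw [show m + d + 1 - m = d + 1 by omega, show m + d + 1 + 1 - (m + 1) = d + 1 by omega,
        show m + d + 1 + 1 - (m + 1 + 1) = d by omega]
      push_cast
      ring

theorem sum_forestMatrix_mul {n N : ℕ} (hn : n < N) (k : ℕ) :
    treeMatrix n k =
      ∑ m ∈ range N, forestMatrix n m * ((m - k).factorial * m.choose k : ℤ) := by
  have telescope (g : ℕ → ℤ) (N : ℕ) :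
      (∑ m ∈ range N, if k ≤ m then g m - g (m + 1) else 0) = if k ≤ N then g k - g N else 0 := by
    induction N with
    | zero => by_cases hk : k = 0 <;> simp [hk]
    | succ N ih =>
      rw [sum_range_succ, ih]
      rcases lt_trichotomy k (N + 1) with h | rfl | h
      · simp [show k ≤ N by omega, show k ≤ N + 1 by omega]
      · simp
      · simp [show ¬ k ≤ N by omega, show ¬ k ≤ N + 1 by omega]
  have hk : (k.factorial : ℤ) ≠ 0 := by exact_mod_cast k.factorial_ne_zero
  refine mul_left_cancel₀ hk ?_
  have hterm (m : ℕ) :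
      (k.factorial : ℤ) * (forestMatrix n m * ((m - k).factorial * m.choose k : ℤ)) =
        if k ≤ m then (n.descFactorial m : ℤ) * (n : ℤ) ^ (n - m) -
          (n.descFactorial (m + 1) : ℤ) * (n : ℤ) ^ (n - (m + 1)) else 0 := by
    split_ifs with h
    · rw [← forestMatrix_mul_factorial, ← Nat.choose_mul_factorial_mul_factorial h]
      push_cast
      ring
    · simp [Nat.choose_eq_zero_of_lt (not_le.1 h)]
  rw [mul_sum, sum_congr rfl fun m _ => hterm m,
    telescope fun m => (n.descFactorial m : ℤ) * (n : ℤ) ^ (n - m), treeMatrix_eq, ← mul_assoc,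
    Nat.descFactorial_of_lt hn, Nat.descFactorial_eq_factorial_mul_choose]
  split_ifs with h
  · simp
  · simp [Nat.choose_eq_zero_of_lt (hn.trans (not_le.1 h))]

theorem minorsNonnegBelow_treeMatrix (N : ℕ) : MinorsNonnegBelow N treeMatrix := by
  induction N with
  | zero => exact (minorsNonnegBelow_choose 0).mul (minorsNonnegBelow_choose 0) (by simp)
  | succ N ih =>
    have hF : MinorsNonnegBelow (N + 1) forestMatrix :=
      (ih.mul (minorsNonnegBelow_choose N) fun _ hi j => sum_treeMatrix_mul_choose hi j).oneSum
    exact hF.mul (minorsNonnegBelow_factorial_mul_choose (N + 1))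
      fun _ hi j => sum_forestMatrix_mul hi j

/-- the matrix `T = (t_{n,k})` is totally positive: every minor
(determinant of a square submatrix with strictly increasing row and column
indices) is nonnegative. -/
theorem treeMatrix_totallyPositive :
    ∀ (k : ℕ) (rows cols : Fin k → ℕ), StrictMono rows → StrictMono cols →
      0 ≤ (Matrix.of fun a b => treeMatrix (rows a) (cols b)).det := by
  intro k r c hr hc
  exact minorsNonnegBelow_treeMatrix (Finset.univ.sup r + 1) k r c hr hc
    fun i => Nat.lt_succ_of_le (Finset.le_sup (Finset.mem_univ i))
end

section
/- The infinite Hankel matrix H = (h_{n,n'})_{n,n'≥0} with entries h_{n,n'} = (n+n')^{n+n'} (with the convention 0^0 = 1), i.e. the Hankel matrix of the sequence (n^n)_{n≥0}, is totally positive: every minor of H is a nonnegative integer. -/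
open MeasureTheory ProbabilityTheory Polynomial Filter Topology

lemma signVariations_lt_card_support {P : ℝ[X]} (hP : P ≠ 0) :
    P.signVariations < P.support.card := by
  induction hm : P.support.card using Nat.strong_induction_on generalizing P with
  | _ m ih =>
  subst hm
  have hlt := eraseLead_support_card_lt hP
  by_cases h0 : P.eraseLead = 0
  · rw [← eraseLead_add_monomial_natDegree_leadingCoeff P, h0, zero_add, signVariations_monomial]
    have : P.leadingCoeff ≠ 0 := leadingCoeff_ne_zero.2 hP
    simp [support_monomial _ this]
  · have := ih _ hlt h0 rfl
    have := signVariations_le_eraseLead_succ P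
    omega

/-- A nonzero real polynomial has fewer distinct positive roots than monomials. -/
lemma card_lt_card_support_of_pos_roots {P : ℝ[X]} (hP : P ≠ 0) (s : Finset ℝ)
    (hs : ∀ x ∈ s, 0 < x ∧ P.IsRoot x) : s.card < P.support.card := by
  refine lt_of_le_of_lt ?_ (signVariations_lt_card_support hP)
  refine le_trans ?_ (roots_countP_pos_le_signVariations P)
  rw [Multiset.countP_eq_card_filter]
  refine Multiset.card_le_card ((Multiset.le_iff_subset s.nodup).2 fun x hx => ?_)
  have := hs x hx
  simpa [hP] using this.symm

/-- Positivity of generalized Vandermonde determinants. -/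
theorem det_pow_pos : ∀ (k : ℕ) (x : Fin k → ℝ) (r : Fin k → ℕ), (∀ i, 0 < x i) →
    StrictMono x → StrictMono r → 0 < (Matrix.of fun i j => x i ^ r j).det := by
  intro k
  induction k with
  | zero => intro x r _ _ _; simp
  | succ k ih =>
  intro x r hx hxm hr
  set c : Fin (k + 1) → ℝ := fun j => (-1) ^ ((Fin.last k : ℕ) + (j : ℕ)) *
    (Matrix.of fun (i : Fin k) (l : Fin k) => x i.castSucc ^ r (j.succAbove l)).det with hc
  set P : ℝ[X] := ∑ j, C (c j) * X ^ r j with hPdef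
  have heval (y : ℝ) : P.eval y =
      (Matrix.of fun i j =>
        (Fin.snoc (fun i : Fin k => x i.castSucc) y : Fin (k + 1) → ℝ) i ^ r j).det := by
    rw [Matrix.det_succ_row _ (Fin.last k), hPdef, eval_finsetSum]
    refine Finset.sum_congr rfl fun j _ => ?_
    simp only [eval_mul, eval_C, eval_pow, eval_X, hc, Matrix.of_apply, Fin.snoc_last]
    rw [mul_right_comm]
    congr 3
    ext a b
    simp [Fin.succAbove_last]
  have hlast : 0 < c (Fin.last k) := by
    simp only [hc, Fin.succAbove_last]
    rw [← two_mul, pow_mul]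
    simpa using ih _ _ (fun i => hx _) (hxm.comp Fin.strictMono_castSucc)
      (hr.comp Fin.strictMono_castSucc)
  have hcoeff : P.coeff (r (Fin.last k)) = c (Fin.last k) := by
    simp [hPdef, coeff_X_pow, hr.injective.eq_iff]
  have hP0 : P ≠ 0 := fun h => by simp [h] at hcoeff; exact hlast.ne hcoeff
  have hsupp : P.support.card ≤ k + 1 := by
    have : P.support ⊆ Finset.univ.image r := by
      intro d hd
      by_contra h
      simp only [Finset.mem_image, Finset.mem_univ, true_and, not_exists] at h
      refine mem_support_iff.1 hd ?_
      simp [hPdef, coeff_X_pow, fun j => Ne.symm (h j)]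
    calc _ ≤ _ := Finset.card_le_card this
      _ ≤ _ := Finset.card_image_le
      _ = _ := by simp
  have hdeg : P.natDegree = r (Fin.last k) := by
    refine le_antisymm ?_ (le_natDegree_of_ne_zero (by rw [hcoeff]; exact hlast.ne'))
    refine natDegree_sum_le_of_forall_le _ _ fun j _ => ?_
    exact (natDegree_C_mul_X_pow_le _ _).trans (hr.monotone (Fin.le_last j))
  have hlead : P.leadingCoeff = c (Fin.last k) := by rw [leadingCoeff, hdeg, hcoeff]
  have hroot (i : Fin k) : P.IsRoot (x i.castSucc) := by
    rw [IsRoot, heval]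
    refine Matrix.det_zero_of_row_eq (i := i.castSucc) (j := Fin.last k) (Fin.castSucc_lt_last i).ne ?_
    ext j
    simp
  have hnroot (y : ℝ) (hy : x (Fin.last k) ≤ y) : ¬ P.IsRoot y := by
    intro hyr
    have hi : Function.Injective (Fin.snoc (fun i : Fin k => x i.castSucc) y : Fin (k + 1) → ℝ) := by
      rw [Fin.snoc_injective_iff]
      refine ⟨fun a b h => Fin.castSucc_injective _ (hxm.injective h), ?_⟩
      rintro ⟨i, hi⟩
      have := hxm (Fin.castSucc_lt_last i)
      simp only at hi
      linarith
    have := card_lt_card_support_of_pos_roots hP0 (s := Finset.univ.image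
      (Fin.snoc (fun i : Fin k => x i.castSucc) y : Fin (k + 1) → ℝ)) (by
        intro z hz
        simp only [Finset.mem_image, Finset.mem_univ, true_and] at hz
        obtain ⟨i, rfl⟩ := hz
        induction i using Fin.lastCases with
        | last => simpa using ⟨(hx _).trans_le hy, hyr⟩
        | cast i => simpa using ⟨hx _, hroot i⟩)
    rw [Finset.card_image_of_injective _ hi] at this
    simp at this
    omega
  have key : 0 < P.eval (x (Fin.last k)) := by
    by_contra! hle
    rcases Nat.eq_zero_or_pos P.natDegree with h0 | hpos
    · rw [eq_C_of_natDegree_eq_zero h0, eval_C, ← h0] at hle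
      rw [← leadingCoeff, hlead] at hle
      linarith
    · have ht := P.tendsto_atTop_of_leadingCoeff_nonneg (natDegree_pos_iff_degree_pos.1 hpos)
        (by rw [hlead]; exact hlast.le)
      obtain ⟨y, hy1, hy2⟩ :=
        ((ht.eventually_ge_atTop 0).and (eventually_ge_atTop (x (Fin.last k)))).exists
      obtain ⟨z, hz, hz0⟩ := intermediate_value_Icc hy2 P.continuous.continuousOn ⟨hle, hy1⟩
      exact hnroot z hz.1 hz0
  rw [heval] at key
  convert key using 5 with i j
  induction i using Fin.lastCases <;> simp

lemma gamma_add_natCast_eq_mul_prod {a : ℝ} (ha : 0 < a) (n : ℕ) :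
    Real.Gamma (a + n) = Real.Gamma a * ∏ i ∈ Finset.range n, (a + i) := by
  induction n with
  | zero => simp
  | succ n ih =>
    rw [Finset.prod_range_succ, ← mul_assoc, ← ih, mul_comm, ← Real.Gamma_add_one (by positivity)]
    push_cast
    ring_nf

/-- `m` is the moment sequence of a measure concentrated on the positive half-line. -/
def IsStieltjesMoment (m : ℕ → ℝ) : Prop :=
  (∀ n, 0 ≤ m n) ∧ ∃ μ : Measure ℝ, (∀ᵐ x ∂μ, 0 < x) ∧
    ∀ n, ∫⁻ x, ENNReal.ofReal (x ^ n) ∂μ = ENNReal.ofReal (m n)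

namespace IsStieltjesMoment

lemma geometric {c : ℝ} (hc : 0 < c) : IsStieltjesMoment fun n => c ^ n := by
  refine ⟨fun n => by positivity, Measure.dirac c, ?_, fun n => ?_⟩
  · simpa [ae_dirac_eq] using hc
  · rw [lintegral_dirac]

lemma isFiniteMeasure {m : ℕ → ℝ} {μ : Measure ℝ}
    (h : ∀ n, ∫⁻ x, ENNReal.ofReal (x ^ n) ∂μ = ENNReal.ofReal (m n)) : IsFiniteMeasure μ := by
  refine ⟨?_⟩
  have := h 0
  simp at this
  simp [this]

lemma mul {m m' : ℕ → ℝ} (h : IsStieltjesMoment m) (h' : IsStieltjesMoment m') :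
    IsStieltjesMoment fun n => m n * m' n := by
  obtain ⟨hm, μ, hμ, H⟩ := h
  obtain ⟨hm', μ', hμ', H'⟩ := h'
  have := isFiniteMeasure H
  have := isFiniteMeasure H'
  have hfst : ∀ᵐ z ∂μ.prod μ', 0 < z.1 := Measure.quasiMeasurePreserving_fst.ae hμ
  have hsnd : ∀ᵐ z ∂μ.prod μ', 0 < z.2 := Measure.quasiMeasurePreserving_snd.ae hμ'
  have hmeas : Measurable fun z : ℝ × ℝ => z.1 * z.2 := by fun_prop
  refine ⟨fun n => mul_nonneg (hm n) (hm' n), (μ.prod μ').map fun z => z.1 * z.2, ?_, fun n => ?_⟩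
  · rw [ae_map_iff hmeas.aemeasurable measurableSet_Ioi]
    filter_upwards [hfst, hsnd] with z h1 h2 using mul_pos h1 h2
  · rw [lintegral_map (by fun_prop) hmeas, ENNReal.ofReal_mul (hm n), ← H n, ← H' n,
      ← lintegral_prod_mul (by fun_prop) (by fun_prop)]
    refine lintegral_congr_ae ?_
    filter_upwards [hfst, hsnd] with z h1 h2
    rw [mul_pow, ENNReal.ofReal_mul (by positivity)]

lemma prod {ι : Type*} (s : Finset ι) {m : ι → ℕ → ℝ} (h : ∀ i ∈ s, IsStieltjesMoment (m i)) :
    IsStieltjesMoment fun n => ∏ i ∈ s, m i n := by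
  classical
  induction s using Finset.induction_on with
  | empty => simpa using geometric one_pos
  | insert a s ha ih =>
    simp only [Finset.prod_insert ha]
    exact (h a (by simp)).mul (ih fun i hi => h i (by simp [hi]))

lemma factorial : IsStieltjesMoment fun n => (n.factorial : ℝ) := by
  refine ⟨fun n => by positivity, gammaMeasure 1 1, ?_, fun n => ?_⟩
  · rw [gammaMeasure, ae_withDensity_iff (by unfold gammaPDF; fun_prop)]
    have : ∀ᵐ x : ℝ, x ≠ 0 := by simp [ae_iff]
    filter_upwards [this] with x hx h
    by_contra! hle
    exact h (gammaPDF_of_neg (lt_of_le_of_ne hle hx))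
  · rw [gammaMeasure, lintegral_withDensity_eq_lintegral_mul _ (by unfold gammaPDF; fun_prop)
      (by fun_prop)]
    have h1 := lintegral_gammaPDF_eq_one (a := n + 1) (r := 1) (by positivity) one_pos
    rw [← mul_one (ENNReal.ofReal _), ← h1, ← lintegral_const_mul _ (by unfold gammaPDF; fun_prop)]
    refine lintegral_congr fun x => ?_
    rcases lt_or_ge x 0 with hx | hx
    · simp [gammaPDF_of_neg hx]
    · rw [Pi.mul_apply, gammaPDF_of_nonneg hx, gammaPDF_of_nonneg hx,
        ← ENNReal.ofReal_mul (by positivity), ← ENNReal.ofReal_mul (by positivity)]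
      congr 1
      have := Real.Gamma_nat_eq_factorial n
      have h2 : (n.factorial : ℝ) ≠ 0 := by positivity
      simp [this]
      field_simp

lemma rising_div_rising {a b : ℝ} (ha : 0 < a) (hab : a < b) :
    IsStieltjesMoment fun n => ∏ i ∈ Finset.range n, (a + i) / (b + i) := by
  have hb : 0 < b - a := sub_pos.2 hab
  have hb0 : 0 < b := ha.trans hab
  have hm : Measurable (betaPDF a (b - a)) := by unfold betaPDF; fun_prop
  refine ⟨fun n => Finset.prod_nonneg fun i _ => by positivity, betaMeasure a (b - a), ?_,
    fun n => ?_⟩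
  · rw [betaMeasure, ae_withDensity_iff hm]
    filter_upwards with x h
    by_contra! hle
    exact h (betaPDF_eq_zero_of_nonpos hle)
  · rw [betaMeasure, lintegral_withDensity_eq_lintegral_mul _ hm (by fun_prop)]
    have h1 := lintegral_betaPDF_eq_one (α := a + n) (β := b - a) (by positivity) hb
    rw [← mul_one (ENNReal.ofReal _), ← h1, ← lintegral_const_mul _ (by unfold betaPDF; fun_prop)]
    refine lintegral_congr fun x => ?_
    by_cases hx : 0 < x ∧ x < 1
    · obtain ⟨h0, hx1⟩ := hx
      rw [Pi.mul_apply, betaPDF_of_pos_lt_one h0 hx1, betaPDF_of_pos_lt_one h0 hx1,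
        ← ENNReal.ofReal_mul' (by positivity),
        ← ENNReal.ofReal_mul (Finset.prod_nonneg fun i _ => by positivity)]
      congr 1
      have hA := (Real.Gamma_pos_of_pos ha).ne'
      have hB := (Real.Gamma_pos_of_pos hb0).ne'
      have hC := (Real.Gamma_pos_of_pos hb).ne'
      have e1 : a + n + (b - a) = b + n := by ring
      have e2 : a + (b - a) = b := by ring
      have e3 : a + n - 1 = (a - 1) + n := by ring
      have hp : ∏ i ∈ Finset.range n, (a + (i : ℝ)) ≠ 0 :=
        (Finset.prod_pos fun i _ => by positivity).ne'
      have hq : ∏ i ∈ Finset.range n, (b + (i : ℝ)) ≠ 0 :=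
        (Finset.prod_pos fun i _ => by positivity).ne'
      rw [Finset.prod_div_distrib, beta, beta, e1, e2, e3, gamma_add_natCast_eq_mul_prod ha,
        gamma_add_natCast_eq_mul_prod hb0,
        Real.rpow_add_natCast h0.ne']
      field_simp
    · have : ∀ α, betaPDF α (b - a) x = 0 := fun α => by
        rw [betaPDF_eq, if_neg hx, ENNReal.ofReal_zero]
      simp [this]

end IsStieltjesMoment

lemma factorial_mul_eq_prod {p : ℕ} (hp : 0 < p) (n : ℕ) :
    ((p * n).factorial : ℝ) =
      ((p : ℝ) ^ p) ^ n * ∏ j ∈ Finset.range p, ∏ i ∈ Finset.range n, (((j : ℝ) + 1) / p + i) := by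
  have hp' : (p : ℝ) ≠ 0 := by positivity
  induction n with
  | zero => simp
  | succ n ih =>
    simp only [Finset.prod_range_succ, Finset.prod_mul_distrib]
    rw [Nat.mul_succ, ← Nat.factorial_mul_ascFactorial, Nat.cast_mul, ih,
      Nat.ascFactorial_eq_prod_range, pow_succ]
    have : ((∏ i ∈ Finset.range p, (p * n + 1 + i) : ℕ) : ℝ) =
        (p : ℝ) ^ p * ∏ j ∈ Finset.range p, (((j : ℝ) + 1) / p + n) := by
      conv_rhs => rw [← Finset.card_range p, ← Finset.prod_const, Finset.card_range,
        ← Finset.prod_mul_distrib]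
      push_cast
      refine Finset.prod_congr rfl fun j _ => ?_
      field_simp
      ring
    rw [this]
    ring

lemma isStieltjesMoment_descFactorial (q : ℕ) (hq : 0 < q) :
    IsStieltjesMoment fun n => (((q + 1) * n).descFactorial n : ℝ) := by
  set c : ℝ := ((q + 1 : ℕ) : ℝ) ^ (q + 1) / (q : ℝ) ^ q with hc
  have hc0 : 0 < c := by positivity
  have h := (IsStieltjesMoment.factorial.mul (.geometric hc0)).mul
    (.prod (Finset.range q) (m := fun j n => ∏ i ∈ Finset.range n,
      (((j : ℝ) + 1) / (q + 1 : ℕ) + i) / (((j : ℝ) + 1) / q + i)) fun j _ =>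
      .rising_div_rising (by positivity) (by gcongr; simp))
  convert h using 2 with n
  have h1 := factorial_mul_eq_prod (Nat.succ_pos q) n
  have h2 := factorial_mul_eq_prod hq n
  have h3 : (((q + 1) * n).descFactorial n : ℝ) * ((q * n).factorial : ℝ) =
      (((q + 1) * n).factorial : ℝ) := by
    rw [mul_comm]
    have := Nat.factorial_mul_descFactorial (n := (q + 1)*n) (k := n) (by nlinarith)
    rw [show (q + 1) * n - n = q * n by rw [Nat.add_mul]; simp] at this
    exact_mod_cast this
  have h4 : ∏ i ∈ Finset.range n, (((q : ℝ) + 1) / (q + 1 : ℕ) + i) = n.factorial := by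
    rw [← Finset.prod_range_add_one_eq_factorial]
    push_cast
    refine Finset.prod_congr rfl fun i _ => ?_
    field_simp
    ring
  rw [Nat.succ_eq_add_one, Finset.prod_range_succ, h4] at h1
  have hne : ((q * n).factorial : ℝ) ≠ 0 := by positivity
  rw [← mul_left_inj' hne, h3, h1, h2]
  have h5 : ∏ j ∈ Finset.range q, ∏ i ∈ Finset.range n, (((j : ℝ) + 1) / q + i) ≠ 0 :=
    Finset.prod_ne_zero_iff.2 fun j _ => Finset.prod_ne_zero_iff.2 fun i _ => by positivity
  simp only [Finset.prod_div_distrib, hc, div_pow]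
  have : ((q : ℝ) ^ q) ^ n ≠ 0 := by positivity
  field_simp

lemma tendsto_descFactorial_div_pow (n : ℕ) :
    Tendsto (fun q : ℕ => (((q + 1) * n).descFactorial n : ℝ) * ((q + 1 : ℝ)⁻¹) ^ n) atTop
      (𝓝 ((n : ℝ) ^ n)) := by
  have h : ∀ q : ℕ, (((q + 1) * n).descFactorial n : ℝ) * ((q + 1 : ℝ)⁻¹) ^ n =
      ∏ i ∈ Finset.range n, ((n : ℝ) - i * (1 / ((q : ℝ) + 1))) := by
    intro q
    have hpow : ((q + 1 : ℝ)⁻¹) ^ n = ∏ _i ∈ Finset.range n, (q + 1 : ℝ)⁻¹ := by simp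
    rw [Nat.descFactorial_eq_prod_range, Nat.cast_prod, hpow, ← Finset.prod_mul_distrib]
    refine Finset.prod_congr rfl fun i hi => ?_
    have hin : i ≤ (q + 1) * n := (Finset.mem_range.1 hi).le.trans (Nat.le_mul_of_pos_left n q.succ_pos)
    rw [Nat.cast_sub hin]
    push_cast
    field_simp
  simp only [h]
  have := tendsto_finsetProd (Finset.range n) fun i _ =>
    (tendsto_const_nhds (x := (n : ℝ))).sub
      ((tendsto_one_div_add_atTop_nhds_zero_nat (𝕜 := ℝ)).const_mul (i : ℝ))
  simpa using this

lemma det_pow_mul_det_pow_nonneg {k : ℕ} (x : Fin k → ℝ) {r c : Fin k → ℕ} (hx : ∀ i, 0 < x i)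
    (hr : StrictMono r) (hc : StrictMono c) :
    0 ≤ (Matrix.of fun i j => x i ^ r j).det * (Matrix.of fun i j => x i ^ c j).det := by
  by_cases hinj : Function.Injective x
  · set σ := Tuple.sort x with hσ
    have hmono : StrictMono (x ∘ σ) :=
      (Tuple.monotone_sort x).strictMono_of_injective (hinj.comp σ.injective)
    have h1 := det_pow_pos k (x ∘ σ) r (fun i => hx _) hmono hr
    have h2 := det_pow_pos k (x ∘ σ) c (fun i => hx _) hmono hc
    have e (s : Fin k → ℕ) : (Matrix.of fun i j => (x ∘ σ) i ^ s j).det =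
        (Equiv.Perm.sign σ : ℝ) * (Matrix.of fun i j => x i ^ s j).det := by
      rw [← Matrix.det_permute]
      rfl
    rw [e] at h1 h2
    have h := mul_pos h1 h2
    rw [mul_mul_mul_comm] at h
    rcases Int.units_eq_one_or (Equiv.Perm.sign σ) with hs | hs <;>
      simpa [hs] using h.le
  · obtain ⟨a, b, hab, hne⟩ : ∃ a b, x a = x b ∧ a ≠ b := by
      simpa [Function.Injective] using hinj
    rw [Matrix.det_zero_of_row_eq hne (by ext j; simp [hab]), zero_mul]

/-- Andréief's identity. -/
theorem factorial_mul_det_integral {α ι : Type*} [MeasurableSpace α] [Fintype ι] [DecidableEq ι]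
    (μ : Measure α) [SigmaFinite μ] (f g : ι → α → ℝ)
    (hfg : ∀ i j, Integrable (fun x => f i x * g j x) μ) :
    ((Fintype.card ι).factorial : ℝ) * (Matrix.of fun i j => ∫ x, f i x * g j x ∂μ).det =
      ∫ x : ι → α, (Matrix.of fun i j => f j (x i)).det * (Matrix.of fun i j => g j (x i)).det
        ∂Measure.pi fun _ => μ := by
  have hint (σ τ : Equiv.Perm ι) : Integrable
      (fun x : ι → α => ∏ i, f (σ i) (x i) * g (τ i) (x i)) (Measure.pi fun _ => μ) :=
    Integrable.fintype_prod (f := fun i y => f (σ i) y * g (τ i) y) fun i => hfg _ _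
  have hexp (x : ι → α) :
      (Matrix.of fun i j => f j (x i)).det * (Matrix.of fun i j => g j (x i)).det =
        ∑ σ : Equiv.Perm ι, ∑ τ : Equiv.Perm ι, ((σ.sign : ℤ) : ℝ) * ((τ.sign : ℤ) : ℝ) *
          ∏ i, f (σ i) (x i) * g (τ i) (x i) := by
    rw [← Matrix.det_transpose, ← Matrix.det_transpose (Matrix.of fun i j => g j (x i)),
      Matrix.det_apply', Matrix.det_apply', Finset.sum_mul_sum]
    refine Finset.sum_congr rfl fun σ _ => Finset.sum_congr rfl fun τ _ => ?_
    simp only [Matrix.transpose_apply, Matrix.of_apply, Finset.prod_mul_distrib]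
    ring
  simp_rw [hexp]
  rw [integral_finsetSum _ fun σ _ => integrable_finsetSum _ fun τ _ => (hint σ τ).const_mul _]
  simp_rw [integral_finsetSum _ fun τ _ => (hint _ τ).const_mul _, integral_const_mul]
  have hτ (τ : Equiv.Perm ι) : (Matrix.of fun i j => ∫ x, f i x * g j x ∂μ).det =
      ∑ σ : Equiv.Perm ι, ((σ.sign : ℤ) : ℝ) * ((τ.sign : ℤ) : ℝ) *
        ∫ x : ι → α, ∏ i, f (σ i) (x i) * g (τ i) (x i) ∂Measure.pi fun _ => μ := by
    have h1 : (Matrix.of fun i j => ∫ x, f i x * g j x ∂μ).det = ((τ.sign : ℤ) : ℝ) *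
        ((Matrix.of fun i j => ∫ x, f i x * g j x ∂μ).submatrix id τ).det := by
      rw [Matrix.det_permute', ← mul_assoc]
      rcases Int.units_eq_one_or (Equiv.Perm.sign τ) with hs | hs <;> simp [hs]
    rw [h1, Matrix.det_apply', Finset.mul_sum]
    refine Finset.sum_congr rfl fun σ _ => ?_
    rw [integral_fintype_prod_eq_prod (f := fun i y => f (σ i) y * g (τ i) y)]
    simp only [Matrix.submatrix_apply, Matrix.of_apply, id]
    ring
  rw [Finset.sum_comm, ← Finset.sum_congr rfl fun τ _ => hτ τ]
  simp [Fintype.card_perm]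

lemma IsStieltjesMoment.det_nonneg {m : ℕ → ℝ} (h : IsStieltjesMoment m) {k : ℕ}
    {r c : Fin k → ℕ} (hr : StrictMono r) (hc : StrictMono c) :
    0 ≤ (Matrix.of fun a b => m (r a + c b)).det := by
  obtain ⟨hm, μ, hμ, H⟩ := h
  have := isFiniteMeasure H
  have hnn (n : ℕ) : 0 ≤ᵐ[μ] fun x => x ^ n := by
    filter_upwards [hμ] with x hx using pow_nonneg hx.le n
  have hint (n : ℕ) : Integrable (fun x => x ^ n) μ := by
    refine ⟨by fun_prop, ?_⟩
    rw [hasFiniteIntegral_iff_ofReal (hnn n), H]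
    exact ENNReal.ofReal_lt_top
  have hI (n : ℕ) : ∫ x, x ^ n ∂μ = m n := by
    rw [integral_eq_lintegral_of_nonneg_ae (hnn n) (by fun_prop), H, ENNReal.toReal_ofReal (hm n)]
  have key := factorial_mul_det_integral μ (fun i x => x ^ r i) (fun i x => x ^ c i)
    fun i j => by simpa only [pow_add] using hint (r i + c j)
  simp only [← pow_add, hI] at key
  refine nonneg_of_mul_nonneg_right (a := ((Fintype.card (Fin k)).factorial : ℝ)) ?_ (by positivity)
  rw [key]
  refine integral_nonneg_of_ae ?_
  have hall : ∀ᵐ x ∂Measure.pi fun _ : Fin k => μ, ∀ i, 0 < x i :=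
    ae_all_iff.2 fun i => (Measure.quasiMeasurePreserving_eval _ i).ae hμ
  filter_upwards [hall] with x hx using det_pow_mul_det_pow_nonneg x hx hr hc

/-- the Hankel matrix of the sequence `(n^n)_{n ≥ 0}` (with
`0^0 = 1`), i.e. the matrix with entries `h_{n,n'} = (n+n')^(n+n')`, is
totally positive: every minor is nonnegative. -/
theorem hankel_nPowN_totallyPositive :
    ∀ (k : ℕ) (rows cols : Fin k → ℕ), StrictMono rows → StrictMono cols →
      0 ≤ (Matrix.of fun a b =>
        ((rows a + cols b : ℕ) : ℤ) ^ (rows a + cols b)).det := by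
  intro k r c hr hc
  have hlim : Tendsto (fun q : ℕ => (Matrix.of fun a b =>
      ((((q + 1) * (r a + c b)).descFactorial (r a + c b) : ℝ) *
        ((q + 1 : ℝ)⁻¹) ^ (r a + c b))).det) atTop
      (𝓝 (Matrix.of fun a b => ((r a + c b : ℕ) : ℝ) ^ (r a + c b)).det) := by
    refine (Continuous.matrix_det continuous_id).continuousAt.tendsto.comp ?_
    exact tendsto_pi_nhds.2 fun a => tendsto_pi_nhds.2 fun b => tendsto_descFactorial_div_pow _
  have hnn := ge_of_tendsto hlim <| (eventually_gt_atTop 0).mono fun q hq =>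
    ((isStieltjesMoment_descFactorial q hq).mul
      (.geometric (c := (q + 1 : ℝ)⁻¹) (by positivity))).det_nonneg hr hc
  have hcast : (((Matrix.of fun a b => ((r a + c b : ℕ) : ℤ) ^ (r a + c b)).det : ℤ) : ℝ) =
      (Matrix.of fun a b => ((r a + c b : ℕ) : ℝ) ^ (r a + c b)).det := by
    rw [Int.cast_det]
    congr 1
    ext a b
    simp
  rw [← hcast] at hnn
  exact_mod_cast hnn
end

section
/- For every n ≥ 1, t_{n,0}(y,φ) = y · t_{n,1}(y,φ) as polynomials in ℤ[y, φ_0, φ_1, …]. -/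
open scoped Classical

/-- A pair `T = (root, parent)` encodes a rooted tree on the vertex set
`Fin n` (vertices `1, …, n` of the paper correspond to `0, …, n-1`, in the
same order): the root is a fixed point of the parent function and every
vertex reaches the root under iteration of the parent function.  Each
non-root vertex `j` has parent `T.2 j`, giving the edge of the tree from
`T.2 j` to its child `j`. -/
def IsRootedTree {n : ℕ} (T : Fin n × (Fin n → Fin n)) : Prop :=
  T.2 T.1 = T.1 ∧ ∀ v, ∃ m : ℕ, T.2^[m] v = T.1

/-- The (finite) set of rooted trees on `Fin n`. -/
noncomputable def rootedTrees (n : ℕ) : Finset (Fin n × (Fin n → Fin n)) :=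
  Finset.univ.filter IsRootedTree

/-- `d` is a descendant of `j` in the rooted tree `T` (every vertex is a
descendant of itself). -/
def Descends {n : ℕ} (T : Fin n × (Fin n → Fin n)) (d j : Fin n) : Prop :=
  ∃ m : ℕ, T.2^[m] d = j

/-- The edge of `T` from `T.2 j` to its child `j` is improper: some
descendant of `j` is smaller than `T.2 j`. -/
def ImproperEdge {n : ℕ} (T : Fin n × (Fin n → Fin n)) (j : Fin n) : Prop :=
  ∃ d : Fin n, Descends T d j ∧ d < T.2 j

/-- The number of improper edges of the rooted tree `T`. -/
noncomputable def imprope {n : ℕ} (T : Fin n × (Fin n → Fin n)) : ℕ :=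
  (Finset.univ.filter fun j => j ≠ T.1 ∧ ImproperEdge T j).card

/-- The number of children of the vertex `i` in the rooted tree `T`. -/
noncomputable def childCount {n : ℕ} (T : Fin n × (Fin n → Fin n)) (i : Fin n) : ℕ :=
  (Finset.univ.filter fun j => j ≠ T.1 ∧ T.2 j = i).card

/-- The number of proper children of the vertex `i` in the rooted tree `T`. -/
noncomputable def pdeg {n : ℕ} (T : Fin n × (Fin n → Fin n)) (i : Fin n) : ℕ :=
  (Finset.univ.filter fun j => j ≠ T.1 ∧ T.2 j = i ∧ ¬ ImproperEdge T j).card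

/-- The generic rooted-tree polynomial `t_{n,k}(y,φ)`, evaluated at elements
`y` and `φ = (φ_m)` of a commutative ring `A`: the sum over all rooted trees
`T` on `[n+1]` in which vertex `1` has exactly `k` children of
`y^{imprope(T)} ∏_{i=2}^{n+1} (pdeg_T(i))! · φ_{pdeg_T(i)}`
(vertex `1` carries no weight). -/
noncomputable def tnkPhi {A : Type*} [CommRing A] (y : A) (φ : ℕ → A) (n k : ℕ) : A :=
  ∑ T ∈ (rootedTrees (n + 1)).filter (fun T => childCount T 0 = k),
    y ^ imprope T *
      ∏ i ∈ Finset.univ.filter (fun i : Fin (n + 1) => i ≠ 0),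
        ((pdeg T i).factorial : A) * φ (pdeg T i)

/-- The indeterminate `y` in `ℤ[y, φ₀, φ₁, …]`. -/
noncomputable def yVar : MvPolynomial (Option ℕ) ℤ := MvPolynomial.X none

/-- The indeterminates `φ_m` in `ℤ[y, φ₀, φ₁, …]`. -/
noncomputable def phiVar (m : ℕ) : MvPolynomial (Option ℕ) ℤ := MvPolynomial.X (some m)

namespace RootedTree

variable {n : ℕ}

/-- Exchange the vertices `0` and `p` of `T`, one of which is the parent of the other, leaving the
parents of all the other vertices unchanged. -/
noncomputable def rotate (p : Fin (n + 1)) (T : Fin (n + 1) × (Fin (n + 1) → Fin (n + 1))) :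
    Fin (n + 1) × (Fin (n + 1) → Fin (n + 1)) :=
  (Equiv.swap 0 p T.1,
    fun j => if j = 0 ∨ j = p then Equiv.swap 0 p (T.2 (Equiv.swap 0 p j)) else T.2 j)

/-- Vertex `0` of `T` is a leaf with parent `p`. -/
structure ZeroLeaf (T : Fin (n + 1) × (Fin (n + 1) → Fin (n + 1))) (p : Fin (n + 1)) : Prop where
  parent_zero : T.2 0 = p
  parent_ne_zero : ∀ j, T.2 j ≠ 0

/-- `p` is the only child of the vertex `0` of `T`. -/
structure ZeroOnlyChild (T : Fin (n + 1) × (Fin (n + 1) → Fin (n + 1))) (p : Fin (n + 1)) :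
    Prop where
  ne_zero : p ≠ 0
  parent_eq_zero : T.2 p = 0
  eq_of_parent_eq_zero : ∀ j, j ≠ T.1 → T.2 j = 0 → j = p

variable {T : Fin (n + 1) × (Fin (n + 1) → Fin (n + 1))} {p : Fin (n + 1)}

theorem rotate_rotate (p : Fin (n + 1)) (T : Fin (n + 1) × (Fin (n + 1) → Fin (n + 1))) :
    rotate p (rotate p T) = T := by
  refine Prod.ext (by simp [rotate]) (funext fun j => ?_)
  by_cases h0 : j = 0
  · subst h0; simp [rotate]
  by_cases hp : j = p
  · subst hp; simp [rotate]
  simp [rotate, h0, hp]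

theorem rotate_apply_of_ne {j : Fin (n + 1)} (h0 : j ≠ 0) (hp : j ≠ p) :
    (rotate p T).2 j = T.2 j := by
  simp [rotate, h0, hp]

theorem rotate_apply_zero : (rotate p T).2 0 = Equiv.swap 0 p (T.2 p) := by
  simp [rotate]

theorem rotate_apply_self : (rotate p T).2 p = Equiv.swap 0 p (T.2 0) := by
  simp [rotate]

theorem descends_refl (d : Fin n) (T : Fin n × (Fin n → Fin n)) : Descends T d d := ⟨0, rfl⟩

theorem descends_of_parent {T : Fin n × (Fin n → Fin n)} {d j : Fin n}
    (h : Descends T (T.2 d) j) : Descends T d j := by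
  obtain ⟨m, hm⟩ := h
  exact ⟨m + 1, hm⟩

theorem descends_parent {T : Fin n × (Fin n → Fin n)} {d j : Fin n}
    (h : Descends T d j) (hne : d ≠ j) : Descends T (T.2 d) j := by
  obtain ⟨m, hm⟩ := h
  cases m with
  | zero => exact absurd hm hne
  | succ m => exact ⟨m, hm⟩

theorem descends_induction {T : Fin n × (Fin n → Fin n)} {j : Fin n} {P : Fin n → Prop}
    (self : P j) (step : ∀ d, P (T.2 d) → P d) {d : Fin n} (h : Descends T d j) : P d := by
  obtain ⟨m, hm⟩ := h
  induction m generalizing d with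
  | zero => exact (show d = j from hm) ▸ self
  | succ m ih => exact step d (ih hm)

theorem root_mem_of_closed {T : Fin n × (Fin n → Fin n)} (hT : IsRootedTree T) {S : Fin n → Prop}
    (hS : ∀ d, S d → S (T.2 d)) {d : Fin n} (hd : S d) : S T.1 :=
  descends_induction (P := fun d => S d → S T.1) id (fun d ih h => ih (hS d h)) (hT.2 d) hd

theorem eq_root_of_fixed {T : Fin n × (Fin n → Fin n)} (hT : IsRootedTree T) {d : Fin n}
    (hd : T.2 d = d) : d = T.1 :=
  (root_mem_of_closed hT (S := fun e => e = d) (by rintro _ rfl; exact hd) rfl).symm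

namespace ZeroLeaf

theorem ne_zero (h : ZeroLeaf T p) : p ≠ 0 := h.parent_zero ▸ h.parent_ne_zero 0

theorem rotate_self (h : ZeroLeaf T p) : (rotate p T).2 p = 0 := by
  rw [rotate_apply_self, h.parent_zero, Equiv.swap_apply_right]

theorem rotate_zero_of_eq (hp : T.2 p = p) : (rotate p T).2 0 = 0 := by
  rw [rotate_apply_zero, hp, Equiv.swap_apply_right]

theorem rotate_zero_of_ne (h : ZeroLeaf T p) (hp : T.2 p ≠ p) : (rotate p T).2 0 = T.2 p := by
  rw [rotate_apply_zero, Equiv.swap_apply_of_ne_of_ne (h.parent_ne_zero p) hp]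

theorem descends_rotate_iff_of_ne (h : ZeroLeaf T p) {d j : Fin (n + 1)} (h0 : j ≠ 0)
    (hp : j ≠ p) : Descends (rotate p T) d j ↔ Descends T d j := by
  constructor <;> intro hd
  · refine descends_induction (P := (Descends T · j)) (descends_refl j T) (fun d ih => ?_) hd
    by_cases hd0 : d = 0
    · subst hd0
      by_cases hpp : T.2 p = p
      · rwa [rotate_zero_of_eq hpp] at ih
      · rw [h.rotate_zero_of_ne hpp] at ih
        refine descends_of_parent ?_
        rw [h.parent_zero]
        exact descends_of_parent ih
    by_cases hdp : d = p
    · subst hdp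
      rw [h.rotate_self] at ih
      simpa [h.parent_zero] using descends_parent ih h0.symm
    rw [rotate_apply_of_ne hd0 hdp] at ih
    exact descends_of_parent ih
  · refine descends_induction (P := (Descends (rotate p T) · j)) (descends_refl j _) (fun d ih => ?_) hd
    by_cases hd0 : d = 0
    · subst hd0
      rw [h.parent_zero] at ih
      simpa [h.rotate_self] using descends_parent ih hp.symm
    by_cases hdp : d = p
    · subst hdp
      by_cases hpp : T.2 d = d
      · rwa [hpp] at ih
      · refine descends_of_parent (descends_of_parent ?_)
        rwa [h.rotate_self, h.rotate_zero_of_ne hpp]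
    refine descends_of_parent ?_
    rwa [rotate_apply_of_ne hd0 hdp]

theorem descends_rotate_zero_iff (h : ZeroLeaf T p) {d : Fin (n + 1)} :
    Descends (rotate p T) d 0 ↔ Descends T d p := by
  have key : Descends T 0 p := descends_of_parent (h.parent_zero ▸ descends_refl _ T)
  have key' : Descends (rotate p T) p 0 :=
    descends_of_parent (h.rotate_self ▸ descends_refl _ _)
  constructor <;> intro hd
  · refine descends_induction (P := (Descends T · p)) key (fun d ih => ?_) hd
    by_cases hd0 : d = 0
    · exact hd0 ▸ key
    by_cases hdp : d = p
    · exact hdp ▸ descends_refl _ T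
    rw [rotate_apply_of_ne hd0 hdp] at ih
    exact descends_of_parent ih
  · refine descends_induction (P := (Descends (rotate p T) · 0)) key' (fun d ih => ?_) hd
    by_cases hd0 : d = 0
    · exact hd0 ▸ descends_refl _ _
    by_cases hdp : d = p
    · exact hdp ▸ key'
    refine descends_of_parent ?_
    rwa [rotate_apply_of_ne hd0 hdp]

theorem isRootedTree_rotate_iff (h : ZeroLeaf T p) (hr : T.1 ≠ 0) :
    IsRootedTree (rotate p T) ↔ IsRootedTree T := by
  by_cases hrp : T.1 = p
  · have h1 : (rotate p T).1 = 0 := by simp [rotate, hrp]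
    refine and_congr ?_ (forall_congr' fun v => ?_)
    · rw [h1, hrp, rotate_apply_zero]
      rw [← Equiv.apply_eq_iff_eq (Equiv.swap 0 p), Equiv.swap_apply_left, Equiv.swap_apply_self]
    · rw [h1, hrp]
      exact h.descends_rotate_zero_iff
  · have h1 : (rotate p T).1 = T.1 := Equiv.swap_apply_of_ne_of_ne hr hrp
    refine and_congr ?_ (forall_congr' fun v => ?_)
    · rw [h1, rotate_apply_of_ne hr hrp]
    · rw [h1]
      exact h.descends_rotate_iff_of_ne hr hrp

theorem root_ne_zero (h : ZeroLeaf T p) (hT : IsRootedTree T) : T.1 ≠ 0 :=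
  fun h0 => h.parent_ne_zero T.1 (hT.1.trans h0)

theorem zeroOnlyChild_rotate (h : ZeroLeaf T p) (hT : IsRootedTree T) :
    ZeroOnlyChild (rotate p T) p where
  ne_zero := h.ne_zero
  parent_eq_zero := h.rotate_self
  eq_of_parent_eq_zero j hj hj0 := by
    by_contra hjp
    by_cases h0 : j = 0
    · subst h0
      exact hj (eq_root_of_fixed ((h.isRootedTree_rotate_iff (h.root_ne_zero hT)).2 hT) hj0)
    · rw [rotate_apply_of_ne h0 hjp] at hj0
      exact h.parent_ne_zero j hj0

theorem improperEdge_rotate_iff (h : ZeroLeaf T p) {j : Fin (n + 1)} (h0 : j ≠ 0) (hp : j ≠ p) :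
    ImproperEdge (rotate p T) j ↔ ImproperEdge T j := by
  simp only [ImproperEdge, h.descends_rotate_iff_of_ne h0 hp, rotate_apply_of_ne h0 hp]

theorem improperEdge_zero (h : ZeroLeaf T p) : ImproperEdge T 0 :=
  ⟨0, descends_refl _ _, Fin.pos_iff_ne_zero.2 (h.parent_ne_zero 0)⟩

theorem improperEdge_self (h : ZeroLeaf T p) : ImproperEdge T p :=
  ⟨0, descends_of_parent (h.parent_zero ▸ descends_refl _ T),
    Fin.pos_iff_ne_zero.2 (h.parent_ne_zero p)⟩

theorem not_improperEdge_rotate_self (h : ZeroLeaf T p) : ¬ ImproperEdge (rotate p T) p := by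
  rintro ⟨d, -, hd⟩
  rw [h.rotate_self] at hd
  exact Fin.not_lt_zero d hd

theorem improperEdge_rotate_zero (h : ZeroLeaf T p) (hpp : T.2 p ≠ p) :
    ImproperEdge (rotate p T) 0 :=
  ⟨0, descends_refl _ _, by
    rw [h.rotate_zero_of_ne hpp]
    exact Fin.pos_iff_ne_zero.2 (h.parent_ne_zero p)⟩

theorem ne_root_rotate_iff (h : ZeroLeaf T p) (hT : IsRootedTree T) {j : Fin (n + 1)}
    (h0 : j ≠ 0) (hp : j ≠ p) : j ≠ (rotate p T).1 ↔ j ≠ T.1 := by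
  by_cases hrp : T.1 = p
  · simp [rotate, hrp, h0, hp]
  · rw [show (rotate p T).1 = T.1 from Equiv.swap_apply_of_ne_of_ne (h.root_ne_zero hT) hrp]

theorem imprope_eq (h : ZeroLeaf T p) (hT : IsRootedTree T) :
    imprope T = imprope (rotate p T) + 1 := by
  have hp0 := h.ne_zero
  have hr := h.root_ne_zero hT
  by_cases hrp : T.1 = p
  · have h1 : (rotate p T).1 = 0 := by simp [rotate, hrp]
    rw [imprope, imprope, ← Finset.card_insert_of_notMem (a := (0 : Fin (n + 1)))]
    · congr 1
      ext j
      simp only [Finset.mem_insert, Finset.mem_filter, Finset.mem_univ, true_and]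
      by_cases h0 : j = 0
      · subst h0
        simp [h.improperEdge_zero, hr.symm]
      by_cases hp : j = p
      · subst hp
        simp [h.not_improperEdge_rotate_self, h0, hrp]
      rw [h.ne_root_rotate_iff hT h0 hp, h.improperEdge_rotate_iff h0 hp]
      simp [h0]
    · simp [h1]
  · have h1 : (rotate p T).1 = T.1 := Equiv.swap_apply_of_ne_of_ne hr hrp
    have hpp : T.2 p ≠ p := fun e => hrp (eq_root_of_fixed hT e).symm
    rw [imprope, imprope, ← Finset.card_insert_of_notMem (a := p)]
    · congr 1
      ext j
      simp only [Finset.mem_insert, Finset.mem_filter, Finset.mem_univ, true_and]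
      by_cases h0 : j = 0
      · subst h0
        simp [h.improperEdge_zero, h.improperEdge_rotate_zero hpp, h1, hr.symm]
      by_cases hp : j = p
      · subst hp
        simp [h.improperEdge_self, Ne.symm hrp]
      rw [h.ne_root_rotate_iff hT h0 hp, h.improperEdge_rotate_iff h0 hp]
      simp [hp]
    · simp [h.not_improperEdge_rotate_self]

theorem pdeg_rotate (h : ZeroLeaf T p) (hT : IsRootedTree T) {i : Fin (n + 1)} (hi : i ≠ 0) :
    pdeg (rotate p T) i = pdeg T i := by
  rw [pdeg, pdeg]
  congr 1
  ext j
  simp only [Finset.mem_filter, Finset.mem_univ, true_and]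
  by_cases h0 : j = 0
  · subst h0
    by_cases hpp : T.2 p = p
    · simp [h.improperEdge_zero, rotate_zero_of_eq hpp, hi.symm]
    · simp [h.improperEdge_zero, h.improperEdge_rotate_zero hpp]
  by_cases hp : j = p
  · subst hp
    simp [h.improperEdge_self, h.rotate_self, hi.symm]
  rw [h.ne_root_rotate_iff hT h0 hp, h.improperEdge_rotate_iff h0 hp, rotate_apply_of_ne h0 hp]

end ZeroLeaf

namespace ZeroOnlyChild

theorem root_ne (h : ZeroOnlyChild T p) (hT : IsRootedTree T) : T.1 ≠ p := fun hr =>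
  h.ne_zero (by rw [← h.parent_eq_zero, ← hr, hT.1])

theorem parent_zero_ne (h : ZeroOnlyChild T p) (hT : IsRootedTree T) : T.2 0 ≠ p := fun hp => by
  have hr : T.1 = 0 ∨ T.1 = p := root_mem_of_closed hT (S := fun d => d = 0 ∨ d = p)
    (by rintro _ (rfl | rfl)
        · exact Or.inr hp
        · exact Or.inl h.parent_eq_zero) (Or.inl rfl)
  rcases hr with hr | hr
  · have := hT.1
    rw [hr, hp] at this
    exact h.ne_zero this
  · exact h.root_ne hT hr

theorem zeroLeaf_rotate (h : ZeroOnlyChild T p) (hT : IsRootedTree T) :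
    ZeroLeaf (rotate p T) p where
  parent_zero := by rw [rotate_apply_zero, h.parent_eq_zero, Equiv.swap_apply_left]
  parent_ne_zero j hj := by
    by_cases h0 : j = 0
    · subst h0
      rw [rotate_apply_zero, h.parent_eq_zero, Equiv.swap_apply_left] at hj
      exact h.ne_zero hj
    by_cases hp : j = p
    · subst hp
      rw [rotate_apply_self, Equiv.swap_apply_eq_iff, Equiv.swap_apply_left] at hj
      exact h.parent_zero_ne hT hj
    rw [rotate_apply_of_ne h0 hp] at hj
    refine hp (h.eq_of_parent_eq_zero j ?_ hj)
    rintro rfl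
    exact h0 (hT.1.symm.trans hj)

theorem isRootedTree_rotate (h : ZeroOnlyChild T p) (hT : IsRootedTree T) :
    IsRootedTree (rotate p T) := by
  refine ((h.zeroLeaf_rotate hT).isRootedTree_rotate_iff ?_).1 ((rotate_rotate p T).symm ▸ hT)
  intro h0
  rw [rotate, Equiv.swap_apply_eq_iff, Equiv.swap_apply_left] at h0
  exact h.root_ne hT h0

end ZeroOnlyChild

theorem childCount_zero_eq_zero_iff (hn : 1 ≤ n) (hT : IsRootedTree T) :
    childCount T 0 = 0 ↔ ZeroLeaf T (T.2 0) := by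
  rw [childCount, Finset.card_eq_zero, Finset.filter_eq_empty_iff]
  constructor
  · refine fun h => ⟨rfl, fun j hj => ?_⟩
    have hr : j = T.1 := by
      by_contra hne
      exact h (Finset.mem_univ j) ⟨hne, hj⟩
    have hr0 : T.1 = 0 := by rw [← hT.1, ← hr, hj]
    have hlast : Fin.last n ≠ 0 := by
      rw [Ne, Fin.ext_iff, Fin.val_last, Fin.val_zero]
      omega
    refine root_mem_of_closed hT (S := fun d => d ≠ 0) (fun d hd hd0 => ?_) hlast hr0
    exact h (Finset.mem_univ d) ⟨hr0.symm ▸ hd, hd0⟩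
  · exact fun h j _ hj => h.parent_ne_zero j hj.2

theorem childCount_zero_eq_one_iff (hT : IsRootedTree T) :
    childCount T 0 = 1 ↔ ∃ p, ZeroOnlyChild T p := by
  rw [childCount, Finset.card_eq_one]
  refine exists_congr fun p => ?_
  simp only [Finset.ext_iff, Finset.mem_filter, Finset.mem_univ, true_and, Finset.mem_singleton]
  constructor
  · intro h
    obtain ⟨hp, hp0⟩ := (h p).2 rfl
    refine ⟨?_, hp0, fun j hj hj0 => (h j).1 ⟨hj, hj0⟩⟩
    rintro rfl
    exact hp (eq_root_of_fixed hT hp0)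
  · refine fun h j => ⟨fun hj => h.eq_of_parent_eq_zero j hj.1 hj.2, ?_⟩
    rintro rfl
    exact ⟨(h.root_ne hT).symm, h.parent_eq_zero⟩

theorem tnkPhi_zero_eq_mul_tnkPhi_one {A : Type*} [CommRing A] (y : A) (φ : ℕ → A)
    (hn : 1 ≤ n) : tnkPhi y φ n 0 = y * tnkPhi y φ n 1 := by
  have mem_zero : ∀ T : Fin (n + 1) × (Fin (n + 1) → Fin (n + 1)),
      T ∈ (rootedTrees (n + 1)).filter (fun T => childCount T 0 = 0) ↔
        IsRootedTree T ∧ ZeroLeaf T (T.2 0) := fun T => by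
    rw [Finset.mem_filter, rootedTrees, Finset.mem_filter]
    simp only [Finset.mem_univ, true_and]
    exact and_congr_right fun hT => childCount_zero_eq_zero_iff hn hT
  have mem_one : ∀ T : Fin (n + 1) × (Fin (n + 1) → Fin (n + 1)),
      T ∈ (rootedTrees (n + 1)).filter (fun T => childCount T 0 = 1) ↔
        IsRootedTree T ∧ ∃ p, ZeroOnlyChild T p := fun T => by
    rw [Finset.mem_filter, rootedTrees, Finset.mem_filter]
    simp only [Finset.mem_univ, true_and]
    exact and_congr_right fun hT => childCount_zero_eq_one_iff hT
  rw [tnkPhi, tnkPhi, Finset.mul_sum]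
  refine Finset.sum_bij (fun T _ => rotate (T.2 0) T) ?_ ?_ ?_ ?_
  · intro T hT
    obtain ⟨hT, h⟩ := (mem_zero T).1 hT
    exact (mem_one _).2 ⟨(h.isRootedTree_rotate_iff (h.root_ne_zero hT)).2 hT, _,
      h.zeroOnlyChild_rotate hT⟩
  · intro T hT T' hT' heq
    obtain ⟨hT, h⟩ := (mem_zero T).1 hT
    obtain ⟨hT', h'⟩ := (mem_zero T').1 hT'
    have hc := h.zeroOnlyChild_rotate hT
    have hc' := h'.zeroOnlyChild_rotate hT'
    have hrot := (h'.isRootedTree_rotate_iff (h'.root_ne_zero hT')).2 hT'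
    rw [heq] at hc
    have hp : T.2 0 = T'.2 0 :=
      hc'.eq_of_parent_eq_zero _ (hc.root_ne hrot).symm hc.parent_eq_zero
    rw [← rotate_rotate (T.2 0) T, heq, hp, rotate_rotate]
  · intro T hT
    obtain ⟨hT, p, h⟩ := (mem_one T).1 hT
    have hl := h.zeroLeaf_rotate hT
    refine ⟨rotate p T, (mem_zero _).2 ⟨h.isRootedTree_rotate hT, ?_⟩, ?_⟩
    · rwa [hl.parent_zero]
    · simp only [hl.parent_zero, rotate_rotate]
  · intro T hT
    obtain ⟨hT, h⟩ := (mem_zero T).1 hT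
    rw [h.imprope_eq hT, pow_succ', mul_assoc]
    congr 2
    refine Finset.prod_congr rfl fun i hi => ?_
    rw [h.pdeg_rotate hT (Finset.mem_filter.1 hi).2]

end RootedTree

/-- for every `n ≥ 1`, `t_{n,0}(y,φ) = y · t_{n,1}(y,φ)` as
polynomials in `ℤ[y, φ₀, φ₁, …]`. -/
theorem tnk_zero_eq_y_mul_tnk_one (n : ℕ) (hn : 1 ≤ n) :
    tnkPhi yVar phiVar n 0 = yVar * tnkPhi yVar phiVar n 1 := by
  exact RootedTree.tnkPhi_zero_eq_mul_tnkPhi_one yVar phiVar hn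
end

section
/- For all n ≥ 0 and 0 ≤ k ≤ n, t_{n,k}(y,φ) = t̃_{n,k}(y,φ) as polynomials in ℤ[y, φ_0, φ_1, …]; that is, the rooted-tree generating polynomial (summed over rooted trees on [n+1] in which vertex 1 has k children) equals the partial-functional-digraph generating polynomial (summed over partial functional digraphs on [n] with k vertices of out-degree 0). -/
open scoped Classical

/- ### Partial functional digraphs -/

/-- A partial functional digraph on `Fin n` is encoded by a function
`f : Fin n → Option (Fin n)`: vertex `j` has out-degree `0` if `f j = none`,
and otherwise the unique outgoing edge `j → i` where `f j = some i`.
`pfdSet n k` is the finite set of those with exactly `k` vertices of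
out-degree `0`. -/
noncomputable def pfdSet (n k : ℕ) : Finset (Fin n → Option (Fin n)) :=
  Finset.univ.filter fun f => (Finset.univ.filter fun i => f i = none).card = k

/-- `u` is a predecessor of `j` in the digraph `f`: there is a directed path
from `u` to `j` (every vertex is a predecessor of itself). -/
def Pred {n : ℕ} (f : Fin n → Option (Fin n)) (u j : Fin n) : Prop :=
  Relation.ReflTransGen (fun a b => f a = some b) u j

/-- The edge `j → i` of `f` is improper: some predecessor of `j` is `≤ i`. -/
def ImproperArc {n : ℕ} (f : Fin n → Option (Fin n)) (j i : Fin n) : Prop :=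
  ∃ u : Fin n, Pred f u j ∧ u ≤ i

/-- The number of improper edges of the partial functional digraph `f`. -/
noncomputable def impropeD {n : ℕ} (f : Fin n → Option (Fin n)) : ℕ :=
  (Finset.univ.filter fun j => ∃ i : Fin n, f j = some i ∧ ImproperArc f j i).card

/-- The proper in-degree of the vertex `i`: the number of proper edges of `f`
entering `i`. -/
noncomputable def pindeg {n : ℕ} (f : Fin n → Option (Fin n)) (i : Fin n) : ℕ :=
  (Finset.univ.filter fun j => f j = some i ∧ ¬ ImproperArc f j i).card

/-- The partial-functional-digraph polynomial `t̃_{n,k}(y,φ)`, evaluated at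
elements `y` and `φ = (φ_m)` of a commutative ring `A`. -/
noncomputable def ttildePhi {A : Type*} [CommRing A] (y : A) (φ : ℕ → A) (n k : ℕ) : A :=
  ∑ f ∈ pfdSet n k,
    y ^ impropeD f *
      ∏ i : Fin n, ((pindeg f i).factorial : A) * φ (pindeg f i)

/- ### Functions modified on their periodic points -/

open Function

section Splice

variable {α : Type*}

theorem iterate_eq_of_notMem {F G : α → α} {C : Set α} (hG : Set.MapsTo G C C)
    (hFG : ∀ x ∉ C, F x = G x) {x : α} (m : ℕ) (h : G^[m] x ∉ C) : F^[m] x = G^[m] x := by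
  induction m with
  | zero => rfl
  | succ m ih =>
    rw [iterate_succ_apply'] at h
    have h' : G^[m] x ∉ C := fun hc => h (hG hc)
    rw [iterate_succ_apply', iterate_succ_apply', ih h', hFG _ h']

/-- `y` is reached from `x` by iterating `F`. -/
def Reaches (F : α → α) (x y : α) : Prop := ∃ m : ℕ, F^[m] x = y

theorem Reaches.trans {F : α → α} {x y z : α} (h : Reaches F x y) (h' : Reaches F y z) :
    Reaches F x z := by
  obtain ⟨m, rfl⟩ := h
  obtain ⟨k, rfl⟩ := h'
  exact ⟨k + m, iterate_add_apply F k m x⟩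

theorem reaches_congr {F G : α → α} {C : Set α} (hF : Set.MapsTo F C C) (hG : Set.MapsTo G C C)
    (hFG : ∀ x ∉ C, F x = G x) {x y : α} (hy : y ∉ C) : Reaches F x y ↔ Reaches G x y := by
  constructor
  · rintro ⟨m, rfl⟩
    exact ⟨m, iterate_eq_of_notMem hF (fun x hx => (hFG x hx).symm) m hy⟩
  · rintro ⟨m, rfl⟩
    exact ⟨m, iterate_eq_of_notMem hG hFG m hy⟩

theorem mapsTo_periodicPts (F : α → α) : Set.MapsTo F (periodicPts F) (periodicPts F) :=
  (bijOn_periodicPts F).mapsTo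

theorem reaches_of_mem_periodicPts {F : α → α} {x : α} (hx : x ∈ periodicPts F) :
    Reaches F (F x) x := by
  obtain ⟨m, hm, h⟩ := hx
  refine ⟨m - 1, ?_⟩
  rw [← iterate_succ_apply, Nat.succ_eq_add_one, Nat.sub_add_cancel hm]
  exact h

theorem mem_periodicPts_of_reaches {F : α → α} {x : α} (h : Reaches F (F x) x) :
    x ∈ periodicPts F := by
  obtain ⟨m, h⟩ := h
  exact ⟨m + 1, m.succ_pos, h⟩

theorem exists_reaches_periodicPts [Finite α] (F : α → α) (x : α) :
    ∃ y ∈ periodicPts F, Reaches F x y := by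
  obtain ⟨a, b, hab, h⟩ := Finite.exists_ne_map_eq_of_infinite fun m : ℕ => F^[m] x
  wlog hlt : a < b generalizing a b
  · exact this b a hab.symm h.symm (by omega)
  refine ⟨F^[a] x, ⟨b - a, by omega, ?_⟩, a, rfl⟩
  change F^[b - a] (F^[a] x) = F^[a] x
  rw [← iterate_add_apply, Nat.sub_add_cancel hlt.le]
  exact h.symm

/-- The function that agrees with `F` off the set `C` and with the permutation `σ` on `C`. -/
noncomputable def splice (F : α → α) (C : Set α) (σ : Equiv.Perm C) (x : α) : α :=
  if h : x ∈ C then σ ⟨x, h⟩ else F x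

theorem splice_coe (F : α → α) (C : Set α) (σ : Equiv.Perm C) (x : C) :
    splice F C σ x = σ x := by
  simp [splice]

theorem splice_of_notMem (F : α → α) {C : Set α} (σ : Equiv.Perm C) {x : α} (h : x ∉ C) :
    splice F C σ x = F x := by
  simp [splice, h]

theorem splice_iterate (F : α → α) (C : Set α) (σ : Equiv.Perm C) (m : ℕ) (x : C) :
    (splice F C σ)^[m] x = (σ ^ m) x := by
  induction m with
  | zero => rfl
  | succ m ih => rw [iterate_succ_apply', ih, splice_coe, pow_succ']; rfl

theorem mapsTo_splice (F : α → α) (C : Set α) (σ : Equiv.Perm C) :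
    Set.MapsTo (splice F C σ) C C := fun x hx => by
  have := (σ ⟨x, hx⟩).2
  rwa [← splice_coe F C σ] at this

theorem periodicPts_splice [Finite α] (F : α → α) (σ : Equiv.Perm (periodicPts F)) :
    periodicPts (splice F _ σ) = periodicPts F := by
  ext x
  constructor
  · rintro ⟨m, hm, h⟩
    by_contra hx
    have h' : (splice F _ σ)^[m] x = x := h
    refine hx ⟨m, hm, ?_⟩
    have := iterate_eq_of_notMem (F := F) (mapsTo_splice F _ σ)
      (fun x hx => (splice_of_notMem F σ hx).symm) m (h'.symm ▸ hx)
    exact this.trans h'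
  · intro hx
    refine ⟨orderOf σ, orderOf_pos σ, ?_⟩
    change (splice F _ σ)^[orderOf σ] (⟨x, hx⟩ : periodicPts F) = x
    rw [splice_iterate, pow_orderOf_eq_one]
    rfl

/-- `G` has the same periodic points as `F` and agrees with `F` off them. -/
def SameTails (F G : α → α) : Prop :=
  periodicPts G = periodicPts F ∧ ∀ x ∉ periodicPts F, G x = F x

theorem sameTails_splice [Finite α] (F : α → α) (σ : Equiv.Perm (periodicPts F)) :
    SameTails F (splice F _ σ) :=
  ⟨periodicPts_splice F σ, fun _ => splice_of_notMem F σ⟩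

theorem SameTails.exists_splice_eq {F G : α → α} (h : SameTails F G) :
    ∃ σ : Equiv.Perm (periodicPts F), splice F _ σ = G := by
  have hb := bijOn_periodicPts G
  rw [h.1] at hb
  refine ⟨hb.equiv, funext fun x => ?_⟩
  by_cases hx : x ∈ periodicPts F
  · exact splice_coe F _ _ ⟨x, hx⟩
  · rw [splice_of_notMem F _ hx, h.2 x hx]

theorem splice_injective (F : α → α) (C : Set α) : Injective (splice F C) := fun σ τ h => by
  ext x
  rw [← splice_coe F C σ, h, splice_coe]

theorem card_sameTails_filter [Fintype α] [DecidableEq α] (F : α → α) (p : (α → α) → Prop)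
    (q : Equiv.Perm (periodicPts F) → Prop) (hpq : ∀ σ, p (splice F _ σ) ↔ q σ)
    [DecidablePred fun G => p G ∧ SameTails F G] [DecidablePred q] :
    (Finset.univ.filter fun G => p G ∧ SameTails F G).card = (Finset.univ.filter q).card := by
  symm
  refine Finset.card_bij (fun σ _ => splice F _ σ) ?_ ?_ ?_
  · intro σ hσ
    simpa [hpq, sameTails_splice] using hσ
  · intro σ _ τ _ h
    exact splice_injective F _ h
  · intro G hG
    simp only [Finset.mem_filter, Finset.mem_univ, true_and] at hG
    obtain ⟨σ, rfl⟩ := hG.2.exists_splice_eq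
    exact ⟨σ, by simpa [hpq] using hG.1, rfl⟩

end Splice

/- ### Permutations fixing a point and transitive cyclic permutations -/

section Perm

variable {β : Type*} [Fintype β] [DecidableEq β]

theorem card_perm_fixing (a : β) [DecidablePred fun σ : Equiv.Perm β => σ a = a] :
    (Finset.univ.filter fun σ : Equiv.Perm β => σ a = a).card
      = (Fintype.card β - 1).factorial := by
  have e := Fintype.card_congr (Equiv.Perm.subtypeEquivSubtypePerm fun x : β => x ≠ a)
  have hc : Fintype.card {x : β // x ≠ a} = Fintype.card β - 1 := by
    simp [Fintype.card_subtype_compl]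
  simp only [Fintype.card_perm, hc, ne_eq, not_not, forall_eq] at e
  rw [e, Fintype.card_subtype]

theorem card_perm_sameCycle (a : β) [DecidablePred fun σ : Equiv.Perm β => ∀ x, σ.SameCycle x a] :
    (Finset.univ.filter fun σ : Equiv.Perm β => ∀ x, σ.SameCycle x a).card
      = (Fintype.card β - 1).factorial := by
  rcases subsingleton_or_nontrivial β with hβ | hβ
  · have h1 : Fintype.card β = 1 := Fintype.card_eq_one_iff.2 ⟨a, fun y => Subsingleton.elim _ _⟩
    rw [Finset.filter_true_of_mem fun σ _ x => Subsingleton.elim a x ▸ Equiv.Perm.SameCycle.refl σ a,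
      Finset.card_univ, Fintype.card_perm, h1]
    rfl
  · have h2 : 2 ≤ Fintype.card β := Fintype.one_lt_card
    have key := Equiv.Perm.card_of_cycleType_singleton (α := β) h2 le_rfl
    rw [Nat.choose_self, mul_one] at key
    rw [← key]
    congr 1
    ext σ
    simp only [Finset.mem_filter, Finset.mem_univ, true_and]
    constructor
    · intro h
      have hne : ∀ x, σ x ≠ x := fun x hx => by
        obtain ⟨b, hb⟩ := exists_ne x
        obtain ⟨i, hi⟩ := (h x).trans (h b).symm
        rw [Equiv.Perm.zpow_apply_eq_self_of_apply_eq_self hx] at hi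
        exact hb hi.symm
      have hc : σ.IsCycle := ⟨a, hne a, fun y _ => (h y).symm⟩
      rw [hc.cycleType, show σ.support = Finset.univ by ext x; simp [hne], Finset.card_univ]
    · intro h
      have hc : σ.IsCycle := by
        rw [← Equiv.Perm.card_cycleType_eq_one, h, Multiset.card_singleton]
      have hs : σ.support = Finset.univ := by
        rw [← Finset.card_eq_iff_eq_univ, ← Equiv.Perm.sum_cycleType, h, Multiset.sum_singleton]
      have hne : ∀ x, σ x ≠ x := fun x => Equiv.Perm.mem_support.1 (hs ▸ Finset.mem_univ x)
      exact fun x => hc.sameCycle (hne x) (hne a)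

end Perm

section Exchange

variable {α : Type*} [Fintype α]

theorem splice_forall_reaches_iff (F : α → α) {a : α} (ha : a ∈ periodicPts F)
    (σ : Equiv.Perm (periodicPts F)) :
    (∀ x, Reaches (splice F _ σ) x a) ↔ ∀ x, σ.SameCycle x ⟨a, ha⟩ := by
  constructor
  · intro h x
    obtain ⟨m, hm⟩ := h x
    rw [splice_iterate] at hm
    exact ⟨m, Subtype.ext (by simpa using hm)⟩
  · intro h x
    obtain ⟨y, hy, hxy⟩ := exists_reaches_periodicPts (splice F _ σ) x
    rw [periodicPts_splice] at hy
    obtain ⟨m, -, hm⟩ := (h ⟨y, hy⟩).exists_pow_eq'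
    exact hxy.trans ⟨m, (splice_iterate F _ σ m ⟨y, hy⟩).trans (congrArg Subtype.val hm)⟩

variable [DecidableEq α]

theorem card_fixing_eq_card_reaching (F : α → α) (a : α)
    [DecidablePred fun G : α → α => G a = a ∧ SameTails F G]
    [DecidablePred fun G : α → α => (∀ x, Reaches G x a) ∧ SameTails F G] :
    (Finset.univ.filter fun G : α → α => G a = a ∧ SameTails F G).card
      = (Finset.univ.filter fun G : α → α => (∀ x, Reaches G x a) ∧ SameTails F G).card := by
  by_cases ha : a ∈ periodicPts F
  · rw [card_sameTails_filter F (fun G => G a = a) (fun σ => σ ⟨a, ha⟩ = ⟨a, ha⟩),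
      card_sameTails_filter F (fun G => ∀ x, Reaches G x a) (fun σ => ∀ x, σ.SameCycle x ⟨a, ha⟩)
        (splice_forall_reaches_iff F ha),
      card_perm_fixing, card_perm_sameCycle]
    intro σ
    rw [show splice F _ σ a = _ from splice_coe F _ σ ⟨a, ha⟩, Subtype.ext_iff]
  · rw [Finset.filter_false_of_mem, Finset.filter_false_of_mem]
    · rintro G - ⟨h, hG⟩
      exact ha (hG.1 ▸ mem_periodicPts_of_reaches (h (G a)))
    · rintro G - ⟨h, hG⟩
      exact ha (hG.1 ▸ ⟨1, one_pos, h⟩)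

theorem sum_fixing_eq_sum_reaching {M : Type*} [AddCommMonoid M] (a : α) (W : (α → α) → M)
    (hW : ∀ F G, SameTails F G → W G = W F) [DecidablePred fun F : α → α => F a = a]
    [DecidablePred fun F : α → α => ∀ x, Reaches F x a] :
    ∑ F ∈ Finset.univ.filter (fun F : α → α => F a = a), W F
      = ∑ F ∈ Finset.univ.filter (fun F : α → α => ∀ x, Reaches F x a), W F := by
  let code : (α → α) → Set α × (α → α) := fun F =>
    (periodicPts F, fun x => if x ∈ periodicPts F then a else F x)
  have hcode : ∀ F G, code G = code F ↔ SameTails F G := by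
    intro F G
    simp only [code, Prod.mk.injEq, SameTails]
    refine and_congr_right fun h => ?_
    rw [h, funext_iff]
    refine forall_congr' fun x => ?_
    by_cases hx : x ∈ periodicPts F <;> simp [hx]
  rw [← Finset.sum_fiberwise _ code, ← Finset.sum_fiberwise _ code]
  refine Finset.sum_congr rfl fun c _ => ?_
  by_cases hc : ∃ F, code F = c
  · obtain ⟨F, rfl⟩ := hc
    simp only [Finset.filter_filter, hcode]
    have hsum : ∀ (p : (α → α) → Prop) [DecidablePred fun G => p G ∧ SameTails F G],
        ∑ G ∈ Finset.univ.filter (fun G => p G ∧ SameTails F G), W G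
          = (Finset.univ.filter fun G => p G ∧ SameTails F G).card • W F := fun p _ =>
      Finset.sum_eq_card_nsmul fun G hG => hW F G (Finset.mem_filter.1 hG).2.2
    rw [hsum fun G => G a = a, hsum fun G => ∀ x, Reaches G x a, card_fixing_eq_card_reaching]
  · rw [Finset.filter_false_of_mem fun F _ h => hc ⟨F, h⟩,
      Finset.filter_false_of_mem fun F _ h => hc ⟨F, h⟩]

end Exchange

/- ### The common weight -/

section Weight

variable {n : ℕ}

/-- Some point from which `j` is reached is smaller than `F j`. -/
def ImproperAt (F : Fin n → Fin n) (j : Fin n) : Prop :=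
  ∃ d, Reaches F d j ∧ d < F j

/-- The number of nonperiodic points that `F` maps to `i`. -/
noncomputable def tailDegree (F : Fin n → Fin n) (i : Fin n) : ℕ :=
  (Finset.univ.filter fun j => j ∉ periodicPts F ∧ F j = i).card

/-- The number of nonperiodic points that `F` maps to `i` by a proper edge. -/
noncomputable def properTailDegree (F : Fin n → Fin n) (i : Fin n) : ℕ :=
  (Finset.univ.filter fun j => j ∉ periodicPts F ∧ F j = i ∧ ¬ ImproperAt F j).card

/-- The number of periodic points minus one, plus the number of nonperiodic points at which `F`
is improper. -/
noncomputable def improperCount (F : Fin n → Fin n) : ℕ :=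
  (Finset.univ.filter fun j => j ∈ periodicPts F).card - 1
    + (Finset.univ.filter fun j => j ∉ periodicPts F ∧ ImproperAt F j).card

/-- The weight shared by rooted trees and partial functional digraphs, as a function of the
associated self-map of `Fin (n + 1)`. -/
noncomputable def tailWeight {A : Type*} [CommRing A] (y : A) (φ : ℕ → A)
    (F : Fin (n + 1) → Fin (n + 1)) : A :=
  y ^ improperCount F *
    ∏ i ∈ Finset.univ.filter (fun i : Fin (n + 1) => i ≠ 0),
      ((properTailDegree F i).factorial : A) * φ (properTailDegree F i)

theorem SameTails.improperAt_iff {F G : Fin n → Fin n} (h : SameTails F G) {j : Fin n}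
    (hj : j ∉ periodicPts F) : ImproperAt G j ↔ ImproperAt F j := by
  have hG := mapsTo_periodicPts G
  rw [h.1] at hG
  simp only [ImproperAt, h.2 j hj, reaches_congr hG (mapsTo_periodicPts F) h.2 hj]

theorem SameTails.tailDegree_eq {F G : Fin n → Fin n} (h : SameTails F G) :
    tailDegree G = tailDegree F := by
  funext i
  unfold tailDegree
  congr 1
  ext j
  simp only [Finset.mem_filter, Finset.mem_univ, true_and, h.1]
  exact and_congr_right fun hj => by rw [h.2 j hj]

theorem SameTails.properTailDegree_eq {F G : Fin n → Fin n} (h : SameTails F G) :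
    properTailDegree G = properTailDegree F := by
  funext i
  unfold properTailDegree
  congr 1
  ext j
  simp only [Finset.mem_filter, Finset.mem_univ, true_and, h.1]
  exact and_congr_right fun hj => by rw [h.2 j hj, h.improperAt_iff hj]

theorem SameTails.improperCount_eq {F G : Fin n → Fin n} (h : SameTails F G) :
    improperCount G = improperCount F := by
  unfold improperCount
  rw [h.1]
  congr 2
  ext j
  simp only [Finset.mem_filter, Finset.mem_univ, true_and]
  exact and_congr_right fun hj => h.improperAt_iff hj

theorem SameTails.tailWeight_eq {A : Type*} [CommRing A] (y : A) (φ : ℕ → A)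
    {F G : Fin (n + 1) → Fin (n + 1)} (h : SameTails F G) :
    tailWeight y φ G = tailWeight y φ F := by
  simp only [tailWeight, h.improperCount_eq, h.properTailDegree_eq]

end Weight

/- ### Rooted trees as self-maps -/

section Trees

variable {n : ℕ} {T : Fin (n + 1) × (Fin (n + 1) → Fin (n + 1))}

/-- The parent function of `T`, modified to send the root to `0`. -/
noncomputable def closeRoot (T : Fin (n + 1) × (Fin (n + 1) → Fin (n + 1))) :
    Fin (n + 1) → Fin (n + 1) :=
  update T.2 T.1 0

theorem closeRoot_root (T : Fin (n + 1) × (Fin (n + 1) → Fin (n + 1))) :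
    closeRoot T T.1 = 0 :=
  update_self ..

theorem closeRoot_of_ne {x : Fin (n + 1)} (h : x ≠ T.1) : closeRoot T x = T.2 x :=
  update_of_ne h ..

theorem reaches_root_of_iterate {F G : Fin n → Fin n} {r : Fin n} (hFG : ∀ x ≠ r, F x = G x)
    (m : ℕ) (x : Fin n) (h : F^[m] x = r) : Reaches G x r := by
  induction m generalizing x with
  | zero => exact ⟨0, h⟩
  | succ m ih =>
    by_cases hx : x = r
    · exact ⟨0, hx⟩
    · obtain ⟨k, hk⟩ := ih (F x) h
      exact ⟨k + 1, by rw [iterate_succ_apply, ← hFG x hx, hk]⟩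

theorem IsRootedTree.closeRoot_reaches_root (hT : IsRootedTree T) (x : Fin (n + 1)) :
    Reaches (closeRoot T) x T.1 := by
  obtain ⟨m, hm⟩ := hT.2 x
  exact reaches_root_of_iterate (fun x hx => (closeRoot_of_ne hx).symm) m x hm

theorem IsRootedTree.closeRoot_reaches_zero (hT : IsRootedTree T) (x : Fin (n + 1)) :
    Reaches (closeRoot T) x 0 :=
  (hT.closeRoot_reaches_root x).trans ⟨1, closeRoot_root T⟩

theorem IsRootedTree.root_mem_periodicPts (hT : IsRootedTree T) :
    T.1 ∈ periodicPts (closeRoot T) :=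
  mem_periodicPts_of_reaches (hT.closeRoot_reaches_root _)

theorem zero_mem_periodicPts {F : Fin (n + 1) → Fin (n + 1)} (h : ∀ x, Reaches F x 0) :
    0 ∈ periodicPts F :=
  mem_periodicPts_of_reaches (h (F 0))

theorem IsRootedTree.mapsTo_parent (hT : IsRootedTree T) :
    Set.MapsTo T.2 (periodicPts (closeRoot T)) (periodicPts (closeRoot T)) := fun x hx => by
  by_cases h : x = T.1
  · rw [h, hT.1]
    exact hT.root_mem_periodicPts
  · rw [← closeRoot_of_ne h]
    exact mapsTo_periodicPts _ hx

theorem IsRootedTree.descends_zero (hT : IsRootedTree T) {x : Fin (n + 1)}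
    (hx : x ∈ periodicPts (closeRoot T)) : Descends T 0 x := by
  have key : ∀ m, Descends T 0 ((closeRoot T)^[m] 0) := by
    intro m
    induction m with
    | zero => exact ⟨0, rfl⟩
    | succ m ih =>
      rw [iterate_succ_apply']
      by_cases h : (closeRoot T)^[m] 0 = T.1
      · exact ⟨0, by rw [h, closeRoot_root]; rfl⟩
      · obtain ⟨k, hk⟩ := ih
        exact ⟨k + 1, by rw [iterate_succ_apply', hk, closeRoot_of_ne h]⟩
  obtain ⟨N, hN, hx⟩ := hx
  obtain ⟨m, hm⟩ := hT.closeRoot_reaches_zero x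
  -- a multiple of the period that is at least `m`
  have hper : (closeRoot T)^[N * m] x = x := (IsPeriodicPt.mul_const hx m :)
  have hle : m ≤ N * m := Nat.le_mul_of_pos_left m hN
  rw [← Nat.sub_add_cancel hle, iterate_add_apply, hm] at hper
  exact hper ▸ key _

theorem IsRootedTree.parent_ne_zero (hT : IsRootedTree T) {x : Fin (n + 1)}
    (hx : x ∈ periodicPts (closeRoot T)) (h : x ≠ T.1) : T.2 x ≠ 0 := fun h0 =>
  h ((bijOn_periodicPts _).injOn hx hT.root_mem_periodicPts
    (by rw [closeRoot_of_ne h, h0, closeRoot_root]))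

theorem IsRootedTree.improperEdge_of_mem (hT : IsRootedTree T) {x : Fin (n + 1)}
    (hx : x ∈ periodicPts (closeRoot T)) (h : x ≠ T.1) : ImproperEdge T x :=
  ⟨0, hT.descends_zero hx, Fin.pos_iff_ne_zero.2 (hT.parent_ne_zero hx h)⟩

theorem IsRootedTree.ne_root_of_notMem (hT : IsRootedTree T) {x : Fin (n + 1)}
    (hx : x ∉ periodicPts (closeRoot T)) : x ≠ T.1 := fun h =>
  hx (h ▸ hT.root_mem_periodicPts)

theorem IsRootedTree.improperEdge_iff (hT : IsRootedTree T) {x : Fin (n + 1)}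
    (hx : x ∉ periodicPts (closeRoot T)) : ImproperEdge T x ↔ ImproperAt (closeRoot T) x := by
  have hagree : ∀ z ∉ periodicPts (closeRoot T), T.2 z = closeRoot T z := fun z hz =>
    (closeRoot_of_ne (hT.ne_root_of_notMem hz)).symm
  unfold ImproperEdge ImproperAt
  rw [hagree x hx]
  exact exists_congr fun d => and_congr_left' <|
    reaches_congr hT.mapsTo_parent (mapsTo_periodicPts _) hagree hx

theorem IsRootedTree.imprope_eq (hT : IsRootedTree T) :
    imprope T = improperCount (closeRoot T) := by
  have hr : T.1 ∈ Finset.univ.filter (fun j => j ∈ periodicPts (closeRoot T)) := by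
    simpa using hT.root_mem_periodicPts
  unfold imprope improperCount
  rw [← Finset.card_erase_of_mem hr, ← Finset.card_union_of_disjoint]
  · congr 1
    ext j
    simp only [Finset.mem_filter, Finset.mem_univ, true_and, Finset.mem_union, Finset.mem_erase]
    by_cases hj : j ∈ periodicPts (closeRoot T)
    · simp only [hj, not_true_eq_false, false_and, or_false, and_true]
      exact and_iff_left_of_imp (hT.improperEdge_of_mem hj)
    · simp [hj, hT.improperEdge_iff hj, hT.ne_root_of_notMem hj]
  · rw [Finset.disjoint_left]
    intro j h h'
    simp only [Finset.mem_filter, Finset.mem_univ, true_and, Finset.mem_erase] at h h'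
    exact h'.1 h.2

theorem IsRootedTree.childCount_zero_eq (hT : IsRootedTree T) :
    childCount T 0 = tailDegree (closeRoot T) 0 := by
  unfold childCount tailDegree
  congr 1
  ext j
  simp only [Finset.mem_filter, Finset.mem_univ, true_and]
  by_cases hj : j ∈ periodicPts (closeRoot T)
  · simp only [hj, not_true_eq_false, false_and, iff_false, not_and]
    exact hT.parent_ne_zero hj
  · have h := hT.ne_root_of_notMem hj
    simp [hj, h, closeRoot_of_ne h]

theorem IsRootedTree.pdeg_eq (hT : IsRootedTree T) (i : Fin (n + 1)) :
    pdeg T i = properTailDegree (closeRoot T) i := by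
  unfold pdeg properTailDegree
  congr 1
  ext j
  simp only [Finset.mem_filter, Finset.mem_univ, true_and]
  by_cases hj : j ∈ periodicPts (closeRoot T)
  · simp only [hj, not_true_eq_false, false_and, iff_false, not_and, not_not]
    exact fun h _ => hT.improperEdge_of_mem hj h
  · have h := hT.ne_root_of_notMem hj
    simp [hj, h, closeRoot_of_ne h, hT.improperEdge_iff hj]

theorem closeRoot_injOn : Set.InjOn (closeRoot (n := n)) {T | IsRootedTree T} := by
  rintro ⟨r, p⟩ (hT : IsRootedTree _) ⟨r', p'⟩ (hT' : IsRootedTree _) h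
  have hr' := hT'.root_mem_periodicPts
  have h0 := closeRoot_root (r', p')
  rw [← h] at hr' h0
  obtain rfl : r = r' := (bijOn_periodicPts _).injOn hT.root_mem_periodicPts hr'
    ((closeRoot_root _).trans h0.symm)
  refine Prod.ext rfl (funext fun x => ?_)
  by_cases hx : x = r
  · subst hx
    exact hT.1.trans hT'.1.symm
  · have := congrFun h x
    rwa [closeRoot_of_ne hx, closeRoot_of_ne hx] at this

theorem exists_closeRoot_eq {F : Fin (n + 1) → Fin (n + 1)} (hF : ∀ x, Reaches F x 0) :
    ∃ T, IsRootedTree T ∧ closeRoot T = F := by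
  obtain ⟨r, hr, hr0⟩ := (bijOn_periodicPts F).surjOn (zero_mem_periodicPts hF)
  refine ⟨(r, update F r r), ⟨update_self .., fun v => ?_⟩, ?_⟩
  · obtain ⟨m, hm⟩ := (hF v).trans (hr0 ▸ reaches_of_mem_periodicPts hr)
    exact reaches_root_of_iterate (fun x hx => (update_of_ne hx ..).symm) m v hm
  · simp [closeRoot, ← hr0]

theorem tnkPhi_eq_sum_reaching {A : Type*} [CommRing A] (y : A) (φ : ℕ → A) (n k : ℕ) :
    tnkPhi y φ n k
      = ∑ F ∈ Finset.univ.filter (fun F : Fin (n + 1) → Fin (n + 1) => ∀ x, Reaches F x 0),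
          if tailDegree F 0 = k then tailWeight y φ F else 0 := by
  unfold tnkPhi
  rw [Finset.sum_filter]
  refine Finset.sum_bij (fun T _ => closeRoot T) ?_ ?_ ?_ ?_
  · intro T hT
    simpa using (Finset.mem_filter.1 hT).2.closeRoot_reaches_zero
  · exact fun T hT T' hT' h =>
      closeRoot_injOn (Finset.mem_filter.1 hT).2 (Finset.mem_filter.1 hT').2 h
  · intro F hF
    obtain ⟨T, hT, rfl⟩ := exists_closeRoot_eq (Finset.mem_filter.1 hF).2
    exact ⟨T, Finset.mem_filter.2 ⟨Finset.mem_univ _, hT⟩, rfl⟩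
  · intro T hT
    have hT := (Finset.mem_filter.1 hT).2
    simp only [tailWeight, hT.childCount_zero_eq, hT.imprope_eq, hT.pdeg_eq]

end Trees

/- ### Partial functional digraphs as self-maps -/

section Digraphs

variable {n : ℕ}

/-- The self-map of `Fin (n + 1)` that fixes `0`, follows the arcs of `f` on successors, and sends
the vertices of out-degree `0` to `0`. -/
def totalize (f : Fin n → Option (Fin n)) : Fin (n + 1) → Fin (n + 1) :=
  Fin.cases 0 fun x => (f x).elim 0 Fin.succ

theorem totalize_zero (f : Fin n → Option (Fin n)) : totalize f 0 = 0 := rfl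

theorem totalize_succ (f : Fin n → Option (Fin n)) (x : Fin n) :
    totalize f x.succ = (f x).elim 0 Fin.succ := rfl

theorem totalize_succ_eq_succ_iff {f : Fin n → Option (Fin n)} {x i : Fin n} :
    totalize f x.succ = i.succ ↔ f x = some i := by
  rw [totalize_succ]
  cases f x <;> simp [(Fin.succ_ne_zero i).symm]

theorem totalize_succ_eq_zero_iff {f : Fin n → Option (Fin n)} {x : Fin n} :
    totalize f x.succ = 0 ↔ f x = none := by
  rw [totalize_succ]
  cases f x <;> simp [Fin.succ_ne_zero]

theorem totalize_iterate_zero (f : Fin n → Option (Fin n)) (m : ℕ) : (totalize f)^[m] 0 = 0 :=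
  iterate_fixed (totalize_zero f) m

theorem zero_mem_periodicPts_totalize (f : Fin n → Option (Fin n)) :
    0 ∈ periodicPts (totalize f) :=
  ⟨1, one_pos, totalize_zero f⟩

theorem reaches_totalize_iff {f : Fin n → Option (Fin n)} {u j : Fin n} :
    Reaches (totalize f) u.succ j.succ ↔ Pred f u j := by
  constructor
  · rintro ⟨m, h⟩
    induction m generalizing u with
    | zero =>
      rw [Fin.succ_injective _ h]
      exact Relation.ReflTransGen.refl
    | succ m ih =>
      rw [iterate_succ_apply] at h
      cases hu : f u with
      | none =>
        rw [totalize_succ_eq_zero_iff.2 hu, totalize_iterate_zero] at h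
        exact absurd h.symm (Fin.succ_ne_zero j)
      | some b =>
        rw [totalize_succ_eq_succ_iff.2 hu] at h
        exact Relation.ReflTransGen.head hu (ih h)
  · intro h
    induction h with
    | refl => exact ⟨0, rfl⟩
    | tail _ hbc ih => exact ih.trans ⟨1, totalize_succ_eq_succ_iff.2 hbc⟩

theorem improperArc_iff {f : Fin n → Option (Fin n)} {i j : Fin n} (hf : f j = some i) :
    ImproperArc f j i ↔ j.succ ∈ periodicPts (totalize f) ∨ ImproperAt (totalize f) j.succ := by
  have hj := totalize_succ_eq_succ_iff.2 hf
  constructor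
  · rintro ⟨u, hu, hui⟩
    rcases hui.eq_or_lt with rfl | hlt
    · exact Or.inl (mem_periodicPts_of_reaches (hj ▸ reaches_totalize_iff.2 hu))
    · exact Or.inr ⟨u.succ, reaches_totalize_iff.2 hu, hj ▸ Fin.succ_lt_succ_iff.2 hlt⟩
  · rintro (h | ⟨d, hd, hlt⟩)
    · exact ⟨i, reaches_totalize_iff.1 (hj ▸ reaches_of_mem_periodicPts h), le_rfl⟩
    · rw [hj] at hlt
      cases d using Fin.cases with
      | zero =>
        obtain ⟨m, hm⟩ := hd
        rw [totalize_iterate_zero] at hm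
        exact absurd hm.symm (Fin.succ_ne_zero j)
      | succ u => exact ⟨u, reaches_totalize_iff.1 hd, (Fin.succ_lt_succ_iff.1 hlt).le⟩

theorem ne_none_of_mem_periodicPts {f : Fin n → Option (Fin n)} {j : Fin n}
    (hj : j.succ ∈ periodicPts (totalize f)) : f j ≠ none := fun h =>
  Fin.succ_ne_zero j ((bijOn_periodicPts _).injOn hj (zero_mem_periodicPts_totalize f)
    (totalize_succ_eq_zero_iff.2 h))

theorem exists_improperArc_iff {f : Fin n → Option (Fin n)} {j : Fin n} :
    (∃ i, f j = some i ∧ ImproperArc f j i)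
      ↔ j.succ ∈ periodicPts (totalize f) ∨ ImproperAt (totalize f) j.succ := by
  cases hf : f j with
  | none =>
    simp only [reduceCtorEq, false_and, exists_false, false_iff, not_or]
    refine ⟨fun h => ne_none_of_mem_periodicPts h hf, ?_⟩
    rintro ⟨d, -, hlt⟩
    rw [totalize_succ_eq_zero_iff.2 hf] at hlt
    exact absurd hlt (Fin.not_lt_zero d)
  | some i => simp [improperArc_iff hf]

theorem card_filter_succ {p : Fin (n + 1) → Prop} [DecidablePred p]
    [DecidablePred fun j : Fin n => p j.succ] (h0 : ¬ p 0) :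
    (Finset.univ.filter p).card = (Finset.univ.filter fun j : Fin n => p j.succ).card := by
  rw [← Finset.card_map (Fin.succEmb n)]
  congr 1
  ext x
  cases x using Fin.cases <;> simp [h0, Fin.succ_ne_zero]

theorem impropeD_eq (f : Fin n → Option (Fin n)) :
    impropeD f = improperCount (totalize f) := by
  have h0 := zero_mem_periodicPts_totalize f
  have h0' : (0 : Fin (n + 1)) ∈ Finset.univ.filter (fun j => j ∈ periodicPts (totalize f)) := by
    simpa using h0
  unfold impropeD improperCount
  rw [← Finset.card_erase_of_mem h0', ← Finset.card_union_of_disjoint]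
  · rw [← Finset.card_map (Fin.succEmb n)]
    congr 1
    ext j
    cases j using Fin.cases with
    | zero => simp [h0, Fin.succ_ne_zero]
    | succ j =>
      by_cases hj : j.succ ∈ periodicPts (totalize f) <;>
        simp [exists_improperArc_iff, hj, Fin.succ_ne_zero]
  · rw [Finset.disjoint_left]
    intro j h h'
    simp only [Finset.mem_filter, Finset.mem_univ, true_and, Finset.mem_erase] at h h'
    exact h'.1 h.2

theorem card_filter_none_eq (f : Fin n → Option (Fin n)) :
    (Finset.univ.filter fun i => f i = none).card = tailDegree (totalize f) 0 := by
  unfold tailDegree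
  rw [card_filter_succ fun h => h.1 (zero_mem_periodicPts_totalize f)]
  congr 1
  ext j
  simp only [Finset.mem_filter, Finset.mem_univ, true_and, totalize_succ_eq_zero_iff]
  exact (and_iff_right_of_imp fun h hj => ne_none_of_mem_periodicPts hj h).symm

theorem pindeg_eq (f : Fin n → Option (Fin n)) (i : Fin n) :
    pindeg f i = properTailDegree (totalize f) i.succ := by
  unfold pindeg properTailDegree
  rw [card_filter_succ fun h => h.1 (zero_mem_periodicPts_totalize f)]
  congr 1
  ext j
  simp only [Finset.mem_filter, Finset.mem_univ, true_and, totalize_succ_eq_succ_iff]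
  rw [and_left_comm]
  exact and_congr_right fun h => by rw [improperArc_iff h, not_or]

theorem prod_filter_ne_zero {A : Type*} [CommMonoid A] (g : Fin (n + 1) → A) :
    ∏ i ∈ Finset.univ.filter (fun i : Fin (n + 1) => i ≠ 0), g i = ∏ i : Fin n, g i.succ := by
  rw [Finset.prod_filter, Fin.prod_univ_succ]
  simp [Fin.succ_ne_zero]

theorem totalize_injective : Injective (totalize (n := n)) := fun f g h => by
  funext x
  have hx := congrFun h x.succ
  cases hg : g x with
  | none => rwa [totalize_succ_eq_zero_iff.2 hg, totalize_succ_eq_zero_iff] at hx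
  | some i => rwa [totalize_succ_eq_succ_iff.2 hg, totalize_succ_eq_succ_iff] at hx

theorem exists_totalize_eq {F : Fin (n + 1) → Fin (n + 1)} (hF : F 0 = 0) :
    ∃ f, totalize f = F := by
  have h : ∀ x : Fin n, ∃ o : Option (Fin n), o.elim 0 Fin.succ = F x.succ := by
    intro x
    cases F x.succ using Fin.cases with
    | zero => exact ⟨none, rfl⟩
    | succ i => exact ⟨some i, rfl⟩
  choose f hf using h
  refine ⟨f, funext fun x => ?_⟩
  cases x using Fin.cases with
  | zero => exact hF.symm
  | succ x => exact hf x

theorem ttildePhi_eq_sum_fixing {A : Type*} [CommRing A] (y : A) (φ : ℕ → A) (n k : ℕ) :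
    ttildePhi y φ n k
      = ∑ F ∈ Finset.univ.filter (fun F : Fin (n + 1) → Fin (n + 1) => F 0 = 0),
          if tailDegree F 0 = k then tailWeight y φ F else 0 := by
  unfold ttildePhi pfdSet
  rw [Finset.sum_filter]
  refine Finset.sum_bij (fun f _ => totalize f) ?_ ?_ ?_ ?_
  · intro f _
    simp [totalize_zero]
  · exact fun f _ g _ h => totalize_injective h
  · intro F hF
    obtain ⟨f, rfl⟩ := exists_totalize_eq (Finset.mem_filter.1 hF).2
    exact ⟨f, Finset.mem_univ _, rfl⟩
  · intro f _
    simp only [tailWeight, card_filter_none_eq, impropeD_eq, pindeg_eq, prod_filter_ne_zero]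

end Digraphs

/-- for all `n ≥ 0` and `0 ≤ k ≤ n`,
`t_{n,k}(y,φ) = t̃_{n,k}(y,φ)` in `ℤ[y, φ₀, φ₁, …]`. -/
theorem tnkPhi_eq_ttildePhi (n k : ℕ) (hk : k ≤ n) :
    tnkPhi yVar phiVar n k = ttildePhi yVar phiVar n k := by
  rw [tnkPhi_eq_sum_reaching, ttildePhi_eq_sum_fixing]
  refine (sum_fixing_eq_sum_reaching 0 _ fun F G h => ?_).symm
  rw [h.tailDegree_eq, h.tailWeight_eq]
end

section
/- The infinite lower-triangular matrix (t_{n,k}(y,z))_{n,k≥0} with entries in ℤ[y,z] is coefficientwise totally positive: every minor is a polynomial in y and z all of whose coefficients are nonnegative integers. -/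
open scoped Classical

/-- The number of proper edges of the rooted tree `T`. -/
noncomputable def prope {n : ℕ} (T : Fin n × (Fin n → Fin n)) : ℕ :=
  (Finset.univ.filter fun j => j ≠ T.1 ∧ ¬ ImproperEdge T j).card

/-- The polynomial `t_{n,k}(y,z) = Σ_T y^{imprope(T)} z^{prope(T)−k}`, the sum
over all rooted trees on `[n+1]` in which vertex `1` has exactly `k`
children, evaluated at elements `y, z` of a commutative ring `A`. -/
noncomputable def tnkYZ {A : Type*} [CommRing A] (y z : A) (n k : ℕ) : A :=
  ∑ T ∈ (rootedTrees (n + 1)).filter (fun T => childCount T 0 = k),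
    y ^ imprope T * z ^ (prope T - k)

namespace TreeMatrix

section TotalPositivity

variable {R : Type*} [CommRing R]

/-- All minors of `A` supported on rows of index `< N` lie in the subsemiring `S`. -/
def MinorsMem (S : Subsemiring R) (N : ℕ) (A : ℕ → ℕ → R) : Prop :=
  ∀ (k : ℕ) (rows cols : Fin k → ℕ), StrictMono rows → StrictMono cols → (∀ a, rows a < N) →
    (Matrix.of fun a b => A (rows a) (cols b)).det ∈ S

variable {S : Subsemiring R} {N : ℕ} {A B : ℕ → ℕ → R}

theorem minorsMem_zero : MinorsMem S 0 A := by
  intro k rows cols _ _ hlt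
  cases k with
  | zero => simp
  | succ k => exact absurd (hlt 0) (Nat.not_lt_zero _)

theorem MinorsMem.congr (hA : MinorsMem S N A) (h : ∀ n < N, ∀ j, B n j = A n j) :
    MinorsMem S N B := by
  intro k rows cols hr hc hlt
  have : (Matrix.of fun a b => B (rows a) (cols b)) =
      Matrix.of fun a b => A (rows a) (cols b) := by
    ext a b
    exact h _ (hlt a) _
  rw [this]
  exact hA k rows cols hr hc hlt

/-- Adding a nonnegative multiple of a column to the preceding one preserves total positivity. -/
theorem MinorsMem.add_next_col (hA : MinorsMem S N A) (j : ℕ) {w : R} (hw : w ∈ S) :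
    MinorsMem S N fun n i => if i = j then A n j + w * A n (j + 1) else A n i := by
  intro k rows cols hr hc hlt
  by_cases hj : ∃ b, cols b = j
  · obtain ⟨b, rfl⟩ := hj
    set M : Matrix (Fin k) (Fin k) R := Matrix.of fun a b => A (rows a) (cols b) with hM
    have hmat : (Matrix.of fun a b' => if cols b' = cols b
        then A (rows a) (cols b) + w * A (rows a) (cols b + 1) else A (rows a) (cols b')) =
        M.updateCol b ((fun a => M a b) + w • fun a => A (rows a) (cols b + 1)) := by
      ext a b'
      by_cases h : b' = b
      · subst h; simp [hM]
      · simp [h, hM, hc.injective.eq_iff]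
    rw [hmat, Matrix.det_updateCol_add, Matrix.det_updateCol_smul]
    have h1 : M.updateCol b (fun a => M a b) = M := Matrix.updateCol_eq_self M b
    rw [h1]
    refine S.add_mem (hA k rows cols hr hc hlt) (S.mul_mem hw ?_)
    by_cases hnext : ∃ b', cols b' = cols b + 1
    · obtain ⟨b', hb'⟩ := hnext
      have hne : b ≠ b' := by
        rintro rfl
        omega
      rw [Matrix.det_zero_of_column_eq hne]
      · exact S.zero_mem
      · intro a
        simp [hne.symm, hM, hb']
    · push Not at hnext
      have hc' : StrictMono (Function.update cols b (cols b + 1)) := by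
        intro u v huv
        have h := hc huv
        simp only [Function.update_apply]
        split_ifs with h1 h2 h2
        · subst h1; subst h2; exact absurd huv (lt_irrefl _)
        · subst h1
          have := hnext v
          omega
        · subst h2; omega
        · exact h
      have hmat' : M.updateCol b (fun a => A (rows a) (cols b + 1)) =
          Matrix.of fun a b' => A (rows a) (Function.update cols b (cols b + 1) b') := by
        ext a b'
        by_cases h : b' = b
        · subst h; simp
        · simp [h, hM]
      rw [hmat']
      exact hA k rows _ hr hc' hlt
  · push Not at hj
    have : (Matrix.of fun a b => if cols b = j
        then A (rows a) j + w * A (rows a) (j + 1) else A (rows a) (cols b)) =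
        Matrix.of fun a b => A (rows a) (cols b) := by
      ext a b
      simp [hj b]
    rw [this]
    exact hA k rows cols hr hc hlt

/-- If the columns of `B` arise from those of `A`, from right to left, by adding to each a
nonnegative multiple of the next column of `B`, then `B` inherits total positivity from `A`. -/
theorem MinorsMem.of_recurrence (hA : MinorsMem S N A) {w : ℕ → R} (hw : ∀ j, w j ∈ S)
    (hB : ∀ n j, n < j → B n j = 0) (h : ∀ n j, B n j = A n j + w j * B n (j + 1)) :
    MinorsMem S N B := by
  have hA0 : ∀ n j, n < j → A n j = 0 := by
    intro n j hj
    have := h n j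
    rw [hB n j hj, hB n (j + 1) (by omega)] at this
    simpa using this.symm
  have key : ∀ d, d ≤ N → MinorsMem S N fun n j => if j + d < N then A n j else B n j := by
    intro d
    induction d with
    | zero =>
      intro _
      refine hA.congr fun n hn j => ?_
      split_ifs with hj
      · rfl
      · rw [hB n j (by omega), hA0 n j (by omega)]
    | succ d ih =>
      intro hd
      refine ((ih (by omega)).add_next_col (N - (d + 1)) (hw (N - (d + 1)))).congr fun n _ j => ?_
      by_cases hj : j = N - (d + 1)
      · have h1 : ¬ (j + (d + 1) < N) := by omega
        have h2 : j + d < N := by omega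
        have h3 : ¬ (j + 1 + d < N) := by omega
        simp only [← hj, if_true, h1, h2, h3, if_false]
        exact h n j
      · have : (j + (d + 1) < N) ↔ (j + d < N) := by omega
        simp [hj, this]
  refine (key N le_rfl).congr fun n _ j => ?_
  simp

/-- Total positivity is preserved on right multiplication by the weighted Pascal matrix. -/
theorem MinorsMem.mul_pascal (hA : MinorsMem S N A) {z : R} (hz : z ∈ S)
    (hA0 : ∀ n j, n < j → A n j = 0) :
    MinorsMem S N fun n m => ∑ j ∈ Finset.range (n + 1), A n j * (j.choose m * z ^ (j - m)) := by
  set C : ℕ → ℕ → ℕ → R := fun i n j =>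
    ∑ d ∈ Finset.range (n + 1), (Nat.multichoose i d : R) * z ^ d * A n (j + d) with hC
  have hCz : ∀ i n j, n < j → C i n j = 0 := fun i n j hj =>
    Finset.sum_eq_zero fun d _ => by rw [hA0 n (j + d) (by omega), mul_zero]
  have hCrec : ∀ i n j, C (i + 1) n j = C i n j + z * C (i + 1) n (j + 1) := by
    intro i n j
    simp only [hC]
    rw [Finset.sum_range_succ' _ n, Finset.sum_range_succ' (fun d => _ * A n (j + d)) n,
      Finset.sum_range_succ _ n, hA0 n (j + 1 + n) (by omega), mul_zero, add_zero (Finset.sum _ _),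
      Finset.mul_sum, add_right_comm, ← Finset.sum_add_distrib]
    congr 1
    · refine Finset.sum_congr rfl fun d _ => ?_
      rw [Nat.multichoose_succ_succ, show j + 1 + d = j + (d + 1) by omega]
      push_cast
      ring
    · simp
  have key : ∀ i, MinorsMem S N fun n j => C (min i (j + 1)) n j := by
    intro i
    induction i with
    | zero =>
      refine hA.congr fun n _ j => ?_
      simp only [hC, Nat.zero_min]
      rw [Finset.sum_range_succ' _ n]
      simp
    | succ i ih =>
      refine ih.of_recurrence (w := fun j => if i ≤ j then z else 0) ?_ ?_ ?_
      · intro j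
        split_ifs
        exacts [hz, S.zero_mem]
      · intro n j hj
        exact hCz _ n j hj
      · intro n j
        split_ifs with hij
        · rw [min_eq_left (by omega), min_eq_left (by omega), min_eq_left (by omega)]
          exact hCrec i n j
        · rw [min_eq_right (by omega), min_eq_right (by omega), zero_mul, add_zero]
  refine (key N).congr fun n hn m => ?_
  by_cases hm : n < m
  · rw [hCz _ n m hm]
    refine Finset.sum_eq_zero fun j hj => ?_
    rw [Nat.choose_eq_zero_of_lt (by have := Finset.mem_range.1 hj; omega)]
    simp
  · rw [min_eq_right (by omega)]
    obtain ⟨e, rfl⟩ := Nat.exists_eq_add_of_le (not_lt.1 hm)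
    have hleft : ∑ j ∈ Finset.range m, A (m + e) j * ((j.choose m : R) * z ^ (j - m)) = 0 :=
      Finset.sum_eq_zero fun j hj => by
        rw [Nat.choose_eq_zero_of_lt (Finset.mem_range.1 hj)]
        simp
    have hright : ∑ d ∈ Finset.range m, (Nat.multichoose (m + 1) (e + 1 + d) : R) *
        z ^ (e + 1 + d) * A (m + e) (m + (e + 1 + d)) = 0 :=
      Finset.sum_eq_zero fun d _ => by rw [hA0 _ _ (by omega), mul_zero]
    simp only [hC]
    conv_lhs => rw [add_assoc, Finset.sum_range_add, hleft, zero_add]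
    conv_rhs =>
      rw [show m + e + 1 = e + 1 + m by omega, Finset.sum_range_add, hright, add_zero]
    refine Finset.sum_congr rfl fun d _ => ?_
    rw [Nat.multichoose_eq, show m + 1 + d - 1 = m + d by omega, Nat.add_sub_cancel_left,
      ← Nat.choose_symm_add]
    ring

/-- Bordering a matrix by a unit row and column preserves total positivity. -/
theorem MinorsMem.border (hA : MinorsMem S N A) (h00 : B 0 0 = 1) (h0 : ∀ j, B 0 (j + 1) = 0)
    (h1 : ∀ n, B (n + 1) 0 = 0) (h : ∀ n j, B (n + 1) (j + 1) = A n j) :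
    MinorsMem S (N + 1) B := by
  have pos : ∀ (k : ℕ) (rows cols : Fin k → ℕ), StrictMono rows → StrictMono cols →
      (∀ a, rows a < N + 1) → (∀ a, 0 < rows a) → (∀ b, 0 < cols b) →
      (Matrix.of fun a b => B (rows a) (cols b)).det ∈ S := by
    intro k rows cols hr hc hlt hr0 hc0
    have : (Matrix.of fun a b => B (rows a) (cols b)) =
        Matrix.of fun a b => A (rows a - 1) (cols b - 1) := by
      ext a b
      have := h (rows a - 1) (cols b - 1)
      rwa [Nat.sub_add_cancel (hr0 a), Nat.sub_add_cancel (hc0 b)] at this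
    rw [this]
    refine hA k (fun a => rows a - 1) (fun b => cols b - 1) ?_ ?_ ?_
    · intro a b hab
      have := hr hab
      have := hr0 a
      dsimp only
      omega
    · intro a b hab
      have := hc hab
      have := hc0 a
      dsimp only
      omega
    · intro a
      have := hlt a
      have := hr0 a
      omega
  intro k rows cols hr hc hlt
  cases k with
  | zero => simp
  | succ k =>
    have hcs : ∀ b : Fin k, 0 < cols b.succ := fun b =>
      (Nat.zero_le _).trans_lt (hc (Fin.succ_pos b))
    have hrs : ∀ b : Fin k, 0 < rows b.succ := fun b =>
      (Nat.zero_le _).trans_lt (hr (Fin.succ_pos b))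
    by_cases hr0 : rows 0 = 0
    · have hz : ∀ b : Fin k, B 0 (cols b.succ) = 0 := fun b => by
        have := h0 (cols b.succ - 1)
        rwa [Nat.sub_add_cancel (hcs b)] at this
      rw [Matrix.det_succ_row_zero, Fin.sum_univ_succ,
        Finset.sum_eq_zero (fun b _ => by simp [hr0, hz]), add_zero]
      simp only [Fin.val_zero, pow_zero, one_mul, Matrix.of_apply, hr0]
      refine S.mul_mem ?_ ?_
      · rcases Nat.eq_zero_or_pos (cols 0) with hc0 | hc0
        · rw [hc0, h00]
          exact S.one_mem
        · have := h0 (cols 0 - 1)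
          rw [Nat.sub_add_cancel hc0] at this
          rw [this]
          exact S.zero_mem
      · exact pos k (fun a => rows a.succ) (fun b => cols b.succ)
          (fun a b hab => hr (Fin.succ_lt_succ_iff.2 hab))
          (fun a b hab => hc (Fin.succ_lt_succ_iff.2 hab)) (fun a => hlt _) hrs hcs
    · have hra : ∀ a, 0 < rows a := fun a =>
        (Nat.pos_of_ne_zero hr0).trans_le (hr.monotone (Fin.zero_le a))
      by_cases hc0 : cols 0 = 0
      · rw [Matrix.det_eq_zero_of_column_eq_zero 0]
        · exact S.zero_mem
        · intro a
          have := h1 (rows a - 1)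
          rw [Nat.sub_add_cancel (hra a)] at this
          simpa [hc0] using this
      · exact pos _ rows cols hr hc hlt hra fun b =>
          (Nat.pos_of_ne_zero hc0).trans_le (hc.monotone (Fin.zero_le b))

end TotalPositivity

section Reach

variable {α : Type*} {f g : α → α} {a b c : α}

/-- `b` is an iterate of `a` under `f`. -/
def Reaches (f : α → α) (a b : α) : Prop := ∃ m : ℕ, f^[m] a = b

theorem Reaches.refl (f : α → α) (a : α) : Reaches f a a := ⟨0, rfl⟩

theorem Reaches.head (h : Reaches f (f a) b) : Reaches f a b :=
  let ⟨m, hm⟩ := h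
  ⟨m + 1, hm⟩

theorem Reaches.head_of_eq (h : Reaches f b c) (hab : f a = b) : Reaches f a c :=
  Reaches.head (hab ▸ h)

theorem Reaches.eq_or_tail (h : Reaches f a b) : a = b ∨ Reaches f (f a) b := by
  obtain ⟨_ | m, hm⟩ := h
  · exact Or.inl hm
  · exact Or.inr ⟨m, hm⟩

theorem Reaches.tail_of_ne (h : Reaches f a b) (hab : a ≠ b) : Reaches f (f a) b :=
  h.eq_or_tail.resolve_left hab

theorem Reaches.eq_of_fixed (h : Reaches f a b) (ha : f a = a) : b = a := by
  obtain ⟨m, rfl⟩ := h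
  exact Function.iterate_fixed ha m

/-- Induction along a path ending in `b`. -/
theorem Reaches.rec_head {b : α} {P : α → Prop} (h : Reaches f a b) (hb : P b)
    (ih : ∀ x, x ≠ b → P (f x) → P x) : P a := by
  obtain ⟨m, hm⟩ := h
  induction m generalizing a with
  | zero => exact (show a = b from hm) ▸ hb
  | succ m hrec =>
    by_cases hab : a = b
    · exact hab ▸ hb
    · exact ih a hab (hrec hm)

theorem Reaches.total (hb : Reaches f a b) (hc : Reaches f a c) :
    Reaches f b c ∨ Reaches f c b := by
  obtain ⟨m, rfl⟩ := hb
  obtain ⟨l, rfl⟩ := hc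
  rcases le_total m l with h | h
  · left
    exact ⟨l - m, by rw [← Function.iterate_add_apply, Nat.sub_add_cancel h]⟩
  · right
    exact ⟨m - l, by rw [← Function.iterate_add_apply, Nat.sub_add_cancel h]⟩

/-- The last point before a fixed point on an orbit is unique. -/
theorem Reaches.unique_last {o : α} (ho : f o = o) (hb : Reaches f a b) (hc : Reaches f a c)
    (hbo : f b = o) (hco : f c = o) (hb0 : b ≠ o) (hc0 : c ≠ o) : b = c := by
  rcases hb.total hc with h | h
  · by_contra hne
    have := h.tail_of_ne hne
    rw [hbo] at this
    exact hc0 (this.eq_of_fixed ho)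
  · by_contra hne
    have := h.tail_of_ne (Ne.symm hne)
    rw [hco] at this
    exact hb0 (this.eq_of_fixed ho)

end Reach

section RootedTrees

variable {n : ℕ} {T : Fin n × (Fin n → Fin n)}

theorem mem_rootedTrees : T ∈ rootedTrees n ↔ IsRootedTree T := by
  simp [rootedTrees]

theorem descends_iff {d j : Fin n} : Descends T d j ↔ Reaches T.2 d j := Iff.rfl

theorem _root_.IsRootedTree.reaches (hT : IsRootedTree T) (v : Fin n) : Reaches T.2 v T.1 := hT.2 v

/-- A vertex of a rooted tree lying on a cycle is the root. -/
theorem _root_.IsRootedTree.eq_root_of_cycle (hT : IsRootedTree T) {v : Fin n}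
    (h : Reaches T.2 (T.2 v) v) : v = T.1 := by
  obtain ⟨m, hm⟩ := h
  obtain ⟨l, hl⟩ := hT.2 v
  have hper : T.2^[m + 1] v = v := hm
  have h1 : T.2^[(m + 1) * l] v = v := by
    rw [Function.iterate_mul]
    exact Function.iterate_fixed hper l
  have h2 : T.2^[(m + 1) * l] v = T.1 := by
    rw [show (m + 1) * l = m * l + l by ring, Function.iterate_add_apply, hl]
    exact Function.iterate_fixed hT.1 _
  exact h1.symm.trans h2

theorem _root_.IsRootedTree.eq_root_of_fixed (hT : IsRootedTree T) {v : Fin n} (h : T.2 v = v) :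
    v = T.1 :=
  hT.eq_root_of_cycle ⟨0, h⟩

end RootedTrees

section Weight

variable {A : Type*} [CommRing A] (y z : A) {n : ℕ}

/-- The children of the smallest vertex. -/
noncomputable def minChildren (T : Fin (n + 1) × (Fin (n + 1) → Fin (n + 1))) :
    Finset (Fin (n + 1)) :=
  Finset.univ.filter fun j => j ≠ T.1 ∧ T.2 j = 0

theorem childCount_zero (T : Fin (n + 1) × (Fin (n + 1) → Fin (n + 1))) :
    childCount T 0 = (minChildren T).card := rfl

theorem mem_minChildren {T : Fin (n + 1) × (Fin (n + 1) → Fin (n + 1))} {j : Fin (n + 1)} :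
    j ∈ minChildren T ↔ j ≠ T.1 ∧ T.2 j = 0 := by
  simp [minChildren]

/-- The contribution to the weight of a rooted tree of the edge from `j` to its parent, where
edges to the smallest vertex have weight one. -/
noncomputable def edgeWeight (T : Fin (n + 1) × (Fin (n + 1) → Fin (n + 1))) (j : Fin (n + 1)) :
    A :=
  if j = T.1 then 1 else if ImproperEdge T j then y else if T.2 j = 0 then 1 else z

theorem not_improperEdge_of_eq_zero {T : Fin (n + 1) × (Fin (n + 1) → Fin (n + 1))}
    {j : Fin (n + 1)} (h : T.2 j = 0) : ¬ ImproperEdge T j := by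
  rintro ⟨d, -, hd⟩
  rw [h] at hd
  exact absurd hd (Fin.not_lt_zero d)

theorem prod_edgeWeight (T : Fin (n + 1) × (Fin (n + 1) → Fin (n + 1))) :
    ∏ j, edgeWeight y z T j = y ^ imprope T * z ^ (prope T - childCount T 0) := by
  have hsplit : ∀ j, edgeWeight y z T j = (if j ≠ T.1 ∧ ImproperEdge T j then y else 1) *
      (if (j ≠ T.1 ∧ ¬ ImproperEdge T j) ∧ ¬ T.2 j = 0 then z else 1) := by
    intro j
    unfold edgeWeight
    by_cases h1 : j = T.1 <;> by_cases h2 : ImproperEdge T j <;> by_cases h3 : T.2 j = 0 <;>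
      simp [h1, h2, h3]
  have hcard : prope T = childCount T 0 +
      (Finset.univ.filter fun j => (j ≠ T.1 ∧ ¬ ImproperEdge T j) ∧ ¬ T.2 j = 0).card := by
    unfold prope childCount
    rw [← Finset.card_filter_add_card_filter_not (s := Finset.univ.filter fun j =>
      j ≠ T.1 ∧ ¬ ImproperEdge T j) (fun j => T.2 j = 0), Finset.filter_filter,
      Finset.filter_filter]
    congr 2
    ext j
    simp only [Finset.mem_filter, Finset.mem_univ, true_and]
    exact ⟨fun h => ⟨h.1.1, h.2⟩, fun h => ⟨⟨h.1, not_improperEdge_of_eq_zero h.2⟩, h.2⟩⟩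
  rw [Finset.prod_congr rfl fun j _ => hsplit j, Finset.prod_mul_distrib, Finset.prod_ite,
    Finset.prod_ite, hcard, Nat.add_sub_cancel_left]
  simp [imprope]

theorem tnkYZ_eq (n k : ℕ) : tnkYZ y z n k =
    ∑ T ∈ (rootedTrees (n + 1)).filter (fun T => childCount T 0 = k),
      ∏ j, edgeWeight y z T j := by
  refine Finset.sum_congr rfl fun T hT => ?_
  rw [prod_edgeWeight, (Finset.mem_filter.1 hT).2]

/-- The analogue of `tnkYZ` for trees rooted at the smallest vertex. -/
noncomputable def minRootedSum (n k : ℕ) : A :=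
  ∑ T ∈ (rootedTrees (n + 1)).filter (fun T => T.1 = 0 ∧ childCount T 0 = k),
    ∏ j, edgeWeight y z T j

theorem childCount_le (T : Fin (n + 1) × (Fin (n + 1) → Fin (n + 1))) : childCount T 0 ≤ n := by
  have : minChildren T ⊂ Finset.univ := by
    rw [Finset.ssubset_univ_iff]
    intro h
    have := Finset.mem_univ T.1
    rw [← h, mem_minChildren] at this
    exact this.1 rfl
  have := Finset.card_lt_card this
  rw [Finset.card_univ, Fintype.card_fin] at this
  exact Nat.lt_succ_iff.1 this

theorem tnkYZ_eq_zero {n k : ℕ} (h : n < k) : tnkYZ y z n k = 0 := by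
  rw [tnkYZ, Finset.filter_false_of_mem, Finset.sum_empty]
  intro T _ hT
  have := childCount_le T
  omega

theorem minRootedSum_zero_zero : minRootedSum y z 0 0 = 1 := by
  have : (rootedTrees 1).filter (fun T => T.1 = 0 ∧ childCount T 0 = 0) =
      {((0 : Fin 1), fun _ => (0 : Fin 1))} := by
    ext T
    simp only [Finset.mem_filter, Finset.mem_singleton, mem_rootedTrees]
    constructor
    · intro _
      exact Subsingleton.elim _ _
    · rintro rfl
      refine ⟨⟨rfl, fun v => ⟨0, Subsingleton.elim _ _⟩⟩, rfl, ?_⟩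
      exact Nat.le_zero.1 (childCount_le _)
  rw [minRootedSum, this, Finset.sum_singleton]
  simp [edgeWeight]

theorem minRootedSum_zero_succ (k : ℕ) : minRootedSum y z 0 (k + 1) = 0 := by
  rw [minRootedSum, Finset.filter_false_of_mem, Finset.sum_empty]
  intro T _ hT
  have := childCount_le T
  omega

theorem minRootedSum_succ_zero (n : ℕ) : minRootedSum y z (n + 1) 0 = 0 := by
  rw [minRootedSum, Finset.filter_false_of_mem, Finset.sum_empty]
  intro T hT ⟨h0, hc⟩
  rw [mem_rootedTrees] at hT
  rw [childCount_zero, Finset.card_eq_zero] at hc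
  have hr := hT.reaches 1
  rw [h0] at hr
  refine hr.rec_head (P := fun x => x ≠ 0 → False) (fun h => h rfl) ?_ (by simp)
  intro x hx ih _
  refine ih fun hx0 => ?_
  have : x ∈ minChildren T := mem_minChildren.2 ⟨h0 ▸ hx, hx0⟩
  rw [hc] at this
  exact absurd this (Finset.notMem_empty x)

end Weight

section Rotation

variable {n : ℕ}

/-- For a tree in which `0` has a parent `q`, hang `q` below `0` and `0` below the former parent
of `q`. -/
noncomputable def rotateUp (T : Fin (n + 1) × (Fin (n + 1) → Fin (n + 1))) :
    Fin (n + 1) × (Fin (n + 1) → Fin (n + 1)) :=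
  (if T.2 0 = T.1 then 0 else T.1,
    fun v => if v = T.2 0 then 0
      else if v = 0 then (if T.2 0 = T.1 then 0 else T.2 (T.2 0)) else T.2 v)

/-- For a child `c` of `0`, hang `0` below `c` and `c` below the former parent of `0`. -/
noncomputable def rotateDown (T : Fin (n + 1) × (Fin (n + 1) → Fin (n + 1))) (c : Fin (n + 1)) :
    Fin (n + 1) × (Fin (n + 1) → Fin (n + 1)) :=
  (if T.1 = 0 then c else T.1,
    fun v => if v = 0 then c else if v = c then (if T.1 = 0 then c else T.2 0) else T.2 v)

variable {T : Fin (n + 1) × (Fin (n + 1) → Fin (n + 1))}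

theorem parent_zero_ne_zero (hT : IsRootedTree T) (h0 : T.1 ≠ 0) : T.2 0 ≠ 0 :=
  fun h => h0 (hT.eq_root_of_fixed h).symm

theorem parent_parent_zero_ne_zero (hT : IsRootedTree T) (h0 : T.1 ≠ 0) : T.2 (T.2 0) ≠ 0 :=
  fun h => h0 (hT.eq_root_of_cycle (v := 0) ⟨1, h⟩).symm

theorem rotateUp_parent : (rotateUp T).2 (T.2 0) = 0 := by simp [rotateUp]

theorem rotateUp_zero (hT : IsRootedTree T) (h0 : T.1 ≠ 0) :
    (rotateUp T).2 0 = if T.2 0 = T.1 then 0 else T.2 (T.2 0) := by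
  simp [rotateUp, (parent_zero_ne_zero hT h0).symm]

theorem rotateUp_of_ne {v : Fin (n + 1)} (hv0 : v ≠ 0) (hvq : v ≠ T.2 0) :
    (rotateUp T).2 v = T.2 v := by simp [rotateUp, hv0, hvq]

theorem eq_rotateUp_root_iff {v : Fin (n + 1)} (hv0 : v ≠ 0) (hvq : v ≠ T.2 0) :
    v = (rotateUp T).1 ↔ v = T.1 := by
  simp only [rotateUp]
  split_ifs with h
  · simp [hv0, ← h, hvq]
  · rfl

theorem parent_ne_rotateUp_root (hT : IsRootedTree T) (h0 : T.1 ≠ 0) :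
    T.2 0 ≠ (rotateUp T).1 := by
  simp only [rotateUp]
  split_ifs with h
  · exact parent_zero_ne_zero hT h0
  · exact h

theorem isRootedTree_rotateUp (hT : IsRootedTree T) (h0 : T.1 ≠ 0) :
    IsRootedTree (rotateUp T) := by
  have hq0 := parent_zero_ne_zero hT h0
  have hqr := parent_ne_rotateUp_root hT h0
  have hfix : (rotateUp T).2 (rotateUp T).1 = (rotateUp T).1 := by
    by_cases hq : T.2 0 = T.1
    · have h1 : (rotateUp T).1 = 0 := by simp [rotateUp, hq]
      rw [h1, rotateUp_zero hT h0, if_pos hq]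
    · have h1 : (rotateUp T).1 = T.1 := by simp [rotateUp, hq]
      rw [h1, rotateUp_of_ne h0 (Ne.symm hq), hT.1]
  refine ⟨hfix, fun v => ?_⟩
  change Reaches (rotateUp T).2 v (rotateUp T).1
  refine (hT.reaches v).rec_head (P := fun v => Reaches (rotateUp T).2 v (rotateUp T).1) ?_ ?_
  · by_cases hq : T.2 0 = T.1
    · rw [← hq]
      refine (Reaches.refl _ _).head_of_eq ?_
      rw [rotateUp_parent]
      simp [rotateUp, hq]
    · have h1 : (rotateUp T).1 = T.1 := by simp [rotateUp, hq]
      rw [h1]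
      exact Reaches.refl _ _
  · intro v hv ih
    by_cases hv0 : v = 0
    · subst hv0
      have := ih.tail_of_ne hqr
      rwa [rotateUp_parent] at this
    · by_cases hvq : v = T.2 0
      · subst hvq
        refine Reaches.head_of_eq ?_ rotateUp_parent
        refine ih.head_of_eq ?_
        rw [rotateUp_zero hT h0, if_neg hv]
      · exact ih.head_of_eq (rotateUp_of_ne hv0 hvq)

theorem reaches_rotateUp_iff (hT : IsRootedTree T) (h0 : T.1 ≠ 0) {d v : Fin (n + 1)}
    (hv0 : v ≠ 0) (hvq : v ≠ T.2 0) : Reaches (rotateUp T).2 d v ↔ Reaches T.2 d v := by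
  constructor
  · intro h
    refine h.rec_head (P := fun d => Reaches T.2 d v) (Reaches.refl _ _) ?_
    intro d hd ih
    by_cases hd0 : d = 0
    · subst hd0
      rw [rotateUp_zero hT h0] at ih
      split_ifs at ih with hq
      · exact ih
      · exact ih.head.head
    · by_cases hdq : d = T.2 0
      · subst hdq
        rw [rotateUp_parent] at ih
        exact ih.tail_of_ne (Ne.symm hv0)
      · rw [rotateUp_of_ne hd0 hdq] at ih
        exact ih.head
  · intro h
    refine h.rec_head (P := fun d => Reaches (rotateUp T).2 d v) (Reaches.refl _ _) ?_
    intro d hd ih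
    by_cases hd0 : d = 0
    · subst hd0
      have := ih.tail_of_ne (Ne.symm hvq)
      rwa [rotateUp_parent] at this
    · by_cases hdq : d = T.2 0
      · subst hdq
        by_cases hq : T.2 0 = T.1
        · rw [hq, hT.1, ← hq] at ih
          exact ih
        · refine Reaches.head_of_eq ?_ rotateUp_parent
          refine ih.head_of_eq ?_
          rw [rotateUp_zero hT h0, if_neg hq]
      · exact ih.head_of_eq (rotateUp_of_ne hd0 hdq)

theorem minChildren_rotateUp (hT : IsRootedTree T) (h0 : T.1 ≠ 0) :
    minChildren (rotateUp T) = insert (T.2 0) (minChildren T) := by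
  have hq0 := parent_zero_ne_zero hT h0
  ext v
  rw [Finset.mem_insert, mem_minChildren, mem_minChildren]
  by_cases hvq : v = T.2 0
  · subst hvq
    simp [rotateUp_parent, parent_ne_rotateUp_root hT h0]
  · by_cases hv0 : v = 0
    · subst hv0
      rw [rotateUp_zero hT h0]
      by_cases hq : T.2 0 = T.1
      · have h1 : (rotateUp T).1 = 0 := by simp [rotateUp, hq]
        simp [h1, hq, h0, h0.symm]
      · simp [hq, hq0, hq0.symm, parent_parent_zero_ne_zero hT h0]
    · rw [rotateUp_of_ne hv0 hvq, Ne, eq_rotateUp_root_iff hv0 hvq]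
      simp [hvq]

theorem childCount_rotateUp (hT : IsRootedTree T) (h0 : T.1 ≠ 0) :
    childCount (rotateUp T) 0 = childCount T 0 + 1 := by
  rw [childCount_zero, childCount_zero, minChildren_rotateUp hT h0, Finset.card_insert_of_notMem]
  rw [mem_minChildren]
  exact fun h => parent_parent_zero_ne_zero hT h0 h.2

theorem prod_edgeWeight_rotateUp {A : Type*} [CommRing A] (y z : A) (hT : IsRootedTree T)
    (h0 : T.1 ≠ 0) :
    ∏ j, edgeWeight y z T j = y * ∏ j, edgeWeight y z (rotateUp T) j := by
  have hq0 := parent_zero_ne_zero hT h0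
  have hpq0 := parent_parent_zero_ne_zero hT h0
  have hmem : T.2 0 ∈ Finset.univ.erase (0 : Fin (n + 1)) :=
    Finset.mem_erase.2 ⟨hq0, Finset.mem_univ _⟩
  have hsplit : ∀ f : Fin (n + 1) → A, ∏ j, f j =
      f 0 * (f (T.2 0) * ∏ j ∈ (Finset.univ.erase 0).erase (T.2 0), f j) := fun f => by
    rw [Finset.mul_prod_erase _ _ hmem, Finset.mul_prod_erase _ _ (Finset.mem_univ _)]
  rw [hsplit, hsplit (edgeWeight y z (rotateUp T))]
  have hrest : ∏ j ∈ (Finset.univ.erase 0).erase (T.2 0), edgeWeight y z T j =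
      ∏ j ∈ (Finset.univ.erase 0).erase (T.2 0), edgeWeight y z (rotateUp T) j := by
    refine Finset.prod_congr rfl fun j hj => ?_
    rw [Finset.mem_erase, Finset.mem_erase] at hj
    have himp : ImproperEdge (rotateUp T) j ↔ ImproperEdge T j := by
      simp only [ImproperEdge, descends_iff, reaches_rotateUp_iff hT h0 hj.2.1 hj.1,
        rotateUp_of_ne hj.2.1 hj.1]
    simp only [edgeWeight, himp, eq_rotateUp_root_iff hj.2.1 hj.1,
      rotateUp_of_ne hj.2.1 hj.1]
  have hw0 : edgeWeight y z T 0 = y := by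
    have : ImproperEdge T 0 := ⟨0, Reaches.refl _ _, Fin.pos_of_ne_zero hq0⟩
    simp [edgeWeight, h0.symm, this]
  have hwq' : edgeWeight y z (rotateUp T) (T.2 0) = 1 := by
    simp [edgeWeight, not_improperEdge_of_eq_zero rotateUp_parent, rotateUp_parent]
  have hwq : edgeWeight y z T (T.2 0) = edgeWeight y z (rotateUp T) 0 := by
    by_cases hq : T.2 0 = T.1
    · have h1 : (rotateUp T).1 = 0 := by simp [rotateUp, hq]
      simp [edgeWeight, hq, h1]
    · have h1 : (rotateUp T).1 = T.1 := by simp [rotateUp, hq]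
      have h2 : (rotateUp T).2 0 = T.2 (T.2 0) := by rw [rotateUp_zero hT h0, if_neg hq]
      have h3 : ImproperEdge T (T.2 0) :=
        ⟨0, (Reaches.refl _ _).head, Fin.pos_of_ne_zero hpq0⟩
      have h4 : ImproperEdge (rotateUp T) 0 :=
        ⟨0, Reaches.refl _ _, by rw [h2]; exact Fin.pos_of_ne_zero hpq0⟩
      simp [edgeWeight, hq, h1, h3, h4, h0.symm]
  rw [hrest, hw0, hwq', hwq]
  ring

theorem isRootedTree_rotateDown (hT : IsRootedTree T) {c : Fin (n + 1)}
    (hc : c ∈ minChildren T) : IsRootedTree (rotateDown T c) := by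
  rw [mem_minChildren] at hc
  have hc0 : c ≠ 0 := by
    rintro rfl
    exact hc.1 (hT.eq_root_of_fixed hc.2)
  have hp0 : (rotateDown T c).2 0 = c := by simp [rotateDown]
  have hpc : (rotateDown T c).2 c = if T.1 = 0 then c else T.2 0 := by simp [rotateDown, hc0]
  have hp : ∀ v, v ≠ 0 → v ≠ c → (rotateDown T c).2 v = T.2 v := fun v h1 h2 => by
    simp [rotateDown, h1, h2]
  have hr0 : (rotateDown T c).1 ≠ 0 := by
    simp only [rotateDown]
    split_ifs with h
    exacts [hc0, h]
  constructor
  · by_cases h0 : T.1 = 0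
    · have h1 : (rotateDown T c).1 = c := by simp [rotateDown, h0]
      rw [h1, hpc, if_pos h0]
    · have h1 : (rotateDown T c).1 = T.1 := by simp [rotateDown, h0]
      rw [h1, hp _ h0 hc.1.symm, hT.1]
  · intro v
    change Reaches (rotateDown T c).2 v (rotateDown T c).1
    refine (hT.reaches v).rec_head
      (P := fun v => Reaches (rotateDown T c).2 v (rotateDown T c).1) ?_ ?_
    · by_cases h0 : T.1 = 0
      · rw [h0]
        refine (Reaches.refl _ _).head_of_eq ?_
        rw [hp0]
        simp [rotateDown, h0]
      · have h1 : (rotateDown T c).1 = T.1 := by simp [rotateDown, h0]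
        rw [h1]
        exact Reaches.refl _ _
    · intro v hv ih
      by_cases hv0 : v = 0
      · subst hv0
        refine Reaches.head_of_eq ?_ hp0
        exact ih.head_of_eq (by rw [hpc, if_neg (Ne.symm hv)])
      · by_cases hvc : v = c
        · subst hvc
          rw [hc.2] at ih
          have := ih.tail_of_ne hr0.symm
          rwa [hp0] at this
        · exact ih.head_of_eq (hp v hv0 hvc)

theorem rotateUp_rotateDown (hT : IsRootedTree T) {c : Fin (n + 1)} (hc : c ∈ minChildren T) :
    rotateUp (rotateDown T c) = T := by
  rw [mem_minChildren] at hc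
  have hc0 : c ≠ 0 := by
    rintro rfl
    exact hc.1 (hT.eq_root_of_fixed hc.2)
  have hp0 : (rotateDown T c).2 0 = c := by simp [rotateDown]
  have hroot : c = (rotateDown T c).1 ↔ T.1 = 0 := by
    simp only [rotateDown]
    split_ifs with h
    · simp [h]
    · simp [h, hc.1]
  refine Prod.ext ?_ (funext fun v => ?_)
  · simp only [rotateUp, hp0, hroot]
    split_ifs with h
    · exact h.symm
    · simp [rotateDown, h]
  · simp only [rotateUp, hp0, hroot]
    split_ifs with h1 h2 h3
    · rw [h1, hc.2]
    · have := hT.1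
      rw [h3] at this
      rw [h2, this]
    · simp [rotateDown, hc0, h3, h2]
    · simp [rotateDown, h1, h2]

theorem rotateDown_rotateUp (hT : IsRootedTree T) (h0 : T.1 ≠ 0) :
    rotateDown (rotateUp T) (T.2 0) = T := by
  have hq0 := parent_zero_ne_zero hT h0
  have hroot : (rotateUp T).1 = 0 ↔ T.2 0 = T.1 := by
    simp only [rotateUp]
    split_ifs with h <;> simp [h, h0]
  refine Prod.ext ?_ (funext fun v => ?_)
  · simp only [rotateDown, hroot]
    split_ifs with h
    · exact h
    · simp [rotateUp, h]
  · simp only [rotateDown, hroot]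
    split_ifs with h1 h2 h3
    · rw [h1]
    · rw [h2, h3, hT.1]
    · rw [rotateUp_zero hT h0, if_neg h3, h2]
    · exact rotateUp_of_ne h1 h2

theorem tnkYZ_recurrence {A : Type*} [CommRing A] (y z : A) (n k : ℕ) :
    tnkYZ y z n k = minRootedSum y z n k + (k + 1) * y * tnkYZ y z n (k + 1) := by
  have hpairs : ∑ T ∈ (rootedTrees (n + 1)).filter (fun T => T.1 ≠ 0 ∧ childCount T 0 = k),
      ∏ j, edgeWeight y z T j =
      ∑ p ∈ ((rootedTrees (n + 1)).filter (fun T => childCount T 0 = k + 1)).sigma minChildren,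
        y * ∏ j, edgeWeight y z p.1 j := by
    refine Finset.sum_bij' (fun T _ => ⟨rotateUp T, T.2 0⟩) (fun p _ => rotateDown p.1 p.2)
      ?_ ?_ ?_ ?_ ?_
    · intro T hT
      rw [Finset.mem_filter, mem_rootedTrees] at hT
      obtain ⟨hT, h0, hk⟩ := hT
      rw [Finset.mem_sigma, Finset.mem_filter, mem_rootedTrees]
      refine ⟨⟨isRootedTree_rotateUp hT h0, by rw [childCount_rotateUp hT h0, hk]⟩, ?_⟩
      rw [minChildren_rotateUp hT h0]
      exact Finset.mem_insert_self _ _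
    · rintro ⟨T, c⟩ hp
      rw [Finset.mem_sigma, Finset.mem_filter, mem_rootedTrees] at hp
      obtain ⟨⟨hT, hk⟩, hc⟩ := hp
      dsimp only at hT hk hc ⊢
      have hD := isRootedTree_rotateDown hT hc
      have hD0 : (rotateDown T c).1 ≠ 0 := by
        rw [mem_minChildren] at hc
        simp only [rotateDown]
        split_ifs with h
        · exact fun h' => hc.1 (h'.trans h.symm)
        · exact h
      rw [Finset.mem_filter, mem_rootedTrees]
      refine ⟨hD, hD0, ?_⟩
      have := childCount_rotateUp hD hD0
      rw [rotateUp_rotateDown hT hc, hk] at this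
      omega
    · intro T hT
      rw [Finset.mem_filter, mem_rootedTrees] at hT
      exact rotateDown_rotateUp hT.1 hT.2.1
    · rintro ⟨T, c⟩ hp
      rw [Finset.mem_sigma, Finset.mem_filter, mem_rootedTrees] at hp
      dsimp only at hp ⊢
      rw [rotateUp_rotateDown hp.1.1 hp.2]
      simp [rotateDown]
    · intro T hT
      rw [Finset.mem_filter, mem_rootedTrees] at hT
      exact prod_edgeWeight_rotateUp y z hT.1 hT.2.1
  rw [tnkYZ_eq, ← Finset.sum_filter_add_sum_filter_not _ (fun T => T.1 = 0),
    Finset.filter_filter, Finset.filter_filter, minRootedSum]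
  simp only [and_comm (a := childCount _ 0 = k)]
  rw [hpairs, Finset.sum_sigma, tnkYZ_eq, Finset.mul_sum]
  congr 1
  refine Finset.sum_congr rfl fun T hT => ?_
  dsimp only
  rw [Finset.sum_const, ← childCount_zero, (Finset.mem_filter.1 hT).2, nsmul_eq_mul]
  push_cast
  ring

end Rotation

section Cone

variable {n : ℕ}

/-- Add a new smallest vertex as root, and hang below it the old root and the vertices in `S`. -/
noncomputable def cone (T : Fin (n + 1) × (Fin (n + 1) → Fin (n + 1)))
    (S : Finset (Fin (n + 1))) : Fin (n + 2) × (Fin (n + 2) → Fin (n + 2)) :=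
  (0, Fin.cases 0 fun v => if v = T.1 ∨ v ∈ S then 0 else (T.2 v).succ)

variable {T : Fin (n + 1) × (Fin (n + 1) → Fin (n + 1))} {S : Finset (Fin (n + 1))}

theorem cone_root : (cone T S).1 = 0 := rfl

theorem cone_zero : (cone T S).2 0 = 0 := rfl

theorem cone_succ (v : Fin (n + 1)) :
    (cone T S).2 v.succ = if v = T.1 ∨ v ∈ S then 0 else (T.2 v).succ := rfl

theorem cone_succ_eq_zero_iff {v : Fin (n + 1)} :
    (cone T S).2 v.succ = 0 ↔ v = T.1 ∨ v ∈ S := by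
  rw [cone_succ]
  split_ifs with h <;> simp [h]

theorem isRootedTree_cone (hT : IsRootedTree T) : IsRootedTree (cone T S) := by
  refine ⟨rfl, fun v => ?_⟩
  change Reaches (cone T S).2 v 0
  refine Fin.cases (Reaches.refl _ _) (fun v => ?_) v
  refine (hT.reaches v).rec_head (P := fun v => Reaches (cone T S).2 v.succ 0) ?_ ?_
  · exact (Reaches.refl _ _).head_of_eq (cone_succ_eq_zero_iff.2 (Or.inl rfl))
  · intro v _ ih
    by_cases h : v = T.1 ∨ v ∈ S
    · exact (Reaches.refl _ _).head_of_eq (cone_succ_eq_zero_iff.2 h)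
    · exact ih.head_of_eq (by rw [cone_succ, if_neg h])

theorem minChildren_cone :
    minChildren (cone T S) = (insert T.1 S).map (Fin.succEmb (n + 1)) := by
  ext v
  rw [mem_minChildren, cone_root]
  refine Fin.cases ?_ (fun v => ?_) v
  · simp [Fin.succ_ne_zero, (Fin.succ_ne_zero _).symm]
  · rw [cone_succ_eq_zero_iff]
    simp

theorem childCount_cone (hS : S ⊆ minChildren T) : childCount (cone T S) 0 = S.card + 1 := by
  rw [childCount_zero, minChildren_cone, Finset.card_map, Finset.card_insert_of_notMem]
  exact fun h => (mem_minChildren.1 (hS h)).1 rfl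

theorem reaches_of_reaches_cone {d v : Fin (n + 1)}
    (h : Reaches (cone T S).2 d.succ v.succ) : Reaches T.2 d v := by
  refine h.rec_head (P := fun x => Reaches (cone T S).2 x v.succ →
    ∀ d : Fin (n + 1), x = d.succ → Reaches T.2 d v) ?_ ?_ h d rfl
  · intro _ d hd
    rw [Fin.succ_injective _ hd]
    exact Reaches.refl _ _
  · rintro x hx ih hxv d rfl
    have hnext := hxv.tail_of_ne hx
    by_cases hd : d = T.1 ∨ d ∈ S
    · rw [cone_succ_eq_zero_iff.2 hd] at hnext
      exact absurd (hnext.eq_of_fixed cone_zero) (Fin.succ_ne_zero v)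
    · exact (ih hnext _ (by rw [cone_succ, if_neg hd])).head

theorem reaches_cone_or (hT : IsRootedTree T) (hS : S ⊆ minChildren T) {d v : Fin (n + 1)}
    (h : Reaches T.2 d v) :
    Reaches (cone T S).2 d.succ v.succ ∨
      Reaches (cone T S).2 (0 : Fin (n + 1)).succ v.succ := by
  refine h.rec_head (P := fun d => Reaches (cone T S).2 d.succ v.succ ∨
      Reaches (cone T S).2 (0 : Fin (n + 1)).succ v.succ) (Or.inl (Reaches.refl _ _)) ?_
  rintro d - (ih | ih)
  · by_cases hr : d = T.1
    · rw [hr, hT.1] at ih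
      rw [hr]
      exact Or.inl ih
    · by_cases hd : d ∈ S
      · rw [(mem_minChildren.1 (hS hd)).2] at ih
        exact Or.inr ih
      · refine Or.inl (ih.head_of_eq ?_)
        rw [cone_succ, if_neg (by simp [hr, hd])]
  · exact Or.inr ih

theorem reaches_cone_one (hT : IsRootedTree T) (hS : S ⊆ minChildren T) :
    Reaches (cone T S).2 (0 : Fin (n + 1)).succ T.1.succ :=
  (reaches_cone_or hT hS (hT.reaches 0)).elim id id

theorem improperEdge_cone_iff (hT : IsRootedTree T) (hS : S ⊆ minChildren T) {v : Fin (n + 1)}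
    (hv : ¬ (v = T.1 ∨ v ∈ S)) : ImproperEdge (cone T S) v.succ ↔ ImproperEdge T v := by
  have hp : (cone T S).2 v.succ = (T.2 v).succ := by rw [cone_succ, if_neg hv]
  simp only [ImproperEdge, descends_iff, hp]
  constructor
  · rintro ⟨d, hd, hlt⟩
    induction d using Fin.cases with
    | zero => exact absurd (hd.eq_of_fixed cone_zero) (Fin.succ_ne_zero v)
    | succ d => exact ⟨d, reaches_of_reaches_cone hd, Fin.succ_lt_succ_iff.1 hlt⟩
  · rintro ⟨d, hd, hlt⟩
    rcases reaches_cone_or hT hS hd with h | h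
    · exact ⟨_, h, Fin.succ_lt_succ_iff.2 hlt⟩
    · exact ⟨_, h, Fin.succ_lt_succ_iff.2 ((Fin.zero_le d).trans_lt hlt)⟩

theorem prod_edgeWeight_cone {A : Type*} [CommRing A] (y z : A) (hT : IsRootedTree T)
    (hS : S ⊆ minChildren T) :
    ∏ j, edgeWeight y z (cone T S) j =
      (∏ j, edgeWeight y z T j) * z ^ (childCount T 0 - S.card) := by
  have hw : ∀ v : Fin (n + 1), edgeWeight y z (cone T S) v.succ =
      edgeWeight y z T v * if v ∈ minChildren T \ S then z else 1 := by
    intro v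
    by_cases hv : v = T.1 ∨ v ∈ S
    · have h0 := cone_succ_eq_zero_iff.2 hv
      have h1 : v ∉ minChildren T \ S := by
        rw [Finset.mem_sdiff, mem_minChildren]
        tauto
      have h2 : edgeWeight y z T v = 1 := by
        rcases hv with hv | hv
        · simp [edgeWeight, hv]
        · have h3 := (mem_minChildren.1 (hS hv)).2
          simp [edgeWeight, h3, not_improperEdge_of_eq_zero h3]
      rw [h2, if_neg h1]
      simp [edgeWeight, h0, not_improperEdge_of_eq_zero h0]
    · have hp : (cone T S).2 v.succ = (T.2 v).succ := by rw [cone_succ, if_neg hv]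
      obtain ⟨hr, hvS⟩ := not_or.1 hv
      by_cases h0 : T.2 v = 0
      · simp [edgeWeight, improperEdge_cone_iff hT hS hv, cone_root, hp, hr, hvS, h0,
          mem_minChildren, not_improperEdge_of_eq_zero h0]
      · simp [edgeWeight, improperEdge_cone_iff hT hS hv, cone_root, hp, hr, hvS, h0,
          mem_minChildren]
  have h0 : edgeWeight y z (cone T S) 0 = 1 := by simp [edgeWeight, cone_root]
  rw [Fin.prod_univ_succ, h0, one_mul, Finset.prod_congr rfl fun v _ => hw v,
    Finset.prod_mul_distrib, Finset.prod_ite_mem, Finset.univ_inter, Finset.prod_const,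
    Finset.card_sdiff_of_subset hS, childCount_zero]

theorem cone_injective {T' : Fin (n + 1) × (Fin (n + 1) → Fin (n + 1))}
    {S' : Finset (Fin (n + 1))} (hT : IsRootedTree T) (hT' : IsRootedTree T')
    (hS : S ⊆ minChildren T) (hS' : S' ⊆ minChildren T') (h : cone T S = cone T' S') :
    T = T' ∧ S = S' := by
  have hroot : T.1 = T'.1 := by
    have h2 := reaches_cone_one hT' hS'
    rw [← h] at h2
    refine Fin.succ_injective _ ((reaches_cone_one hT hS).unique_last cone_zero h2
      (cone_succ_eq_zero_iff.2 (Or.inl rfl)) ?_ (Fin.succ_ne_zero _) (Fin.succ_ne_zero _))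
    rw [h]
    exact cone_succ_eq_zero_iff.2 (Or.inl rfl)
  have hSS : S = S' := by
    ext v
    have h1 : v = T.1 ∨ v ∈ S ↔ v = T'.1 ∨ v ∈ S' := by
      rw [← cone_succ_eq_zero_iff, h, cone_succ_eq_zero_iff]
    rw [← hroot] at h1
    have h2 : v ∈ S → v ≠ T.1 := fun hv => (mem_minChildren.1 (hS hv)).1
    have h3 : v ∈ S' → v ≠ T.1 := fun hv => hroot ▸ (mem_minChildren.1 (hS' hv)).1
    tauto
  refine ⟨Prod.ext hroot (funext fun v => ?_), hSS⟩
  by_cases hv : v = T.1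
  · have h' := hT'.1
    rw [← hroot] at h'
    rw [hv, hT.1, h']
  · by_cases hvS : v ∈ S
    · rw [(mem_minChildren.1 (hS hvS)).2, (mem_minChildren.1 (hS' (hSS ▸ hvS))).2]
    · have h1 : (cone T S).2 v.succ = (cone T' S').2 v.succ := by rw [h]
      rw [cone_succ, cone_succ, ← hroot, ← hSS, if_neg (by simp [hv, hvS]),
        if_neg (by simp [hv, hvS])] at h1
      exact Fin.succ_injective _ h1

theorem exists_cone_eq {U : Fin (n + 2) × (Fin (n + 2) → Fin (n + 2))} (hU : IsRootedTree U)
    (h0 : U.1 = 0) :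
    ∃ (T : Fin (n + 1) × (Fin (n + 1) → Fin (n + 1))) (S : Finset (Fin (n + 1))),
      IsRootedTree T ∧ S ⊆ minChildren T ∧ cone T S = U := by
  have hU0 : U.2 0 = 0 := by
    have := hU.1
    rwa [h0] at this
  have hreach : ∀ v, Reaches U.2 v 0 := fun v => h0 ▸ hU.reaches v
  obtain ⟨c, hc1, hc0⟩ : ∃ c : Fin (n + 1),
      Reaches U.2 (0 : Fin (n + 1)).succ c.succ ∧ U.2 c.succ = 0 := by
    refine (hreach (0 : Fin (n + 1)).succ).rec_head (P := fun x => x ≠ 0 →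
      ∃ c : Fin (n + 1), Reaches U.2 x c.succ ∧ U.2 c.succ = 0) (fun h => absurd rfl h) ?_
      (Fin.succ_ne_zero _)
    intro x _ ih hx
    obtain ⟨v, rfl⟩ := Fin.exists_succ_eq.2 hx
    by_cases hv : U.2 v.succ = 0
    · exact ⟨v, Reaches.refl _ _, hv⟩
    · obtain ⟨c, h1, h2⟩ := ih hv
      exact ⟨c, h1.head, h2⟩
  set T : Fin (n + 1) × (Fin (n + 1) → Fin (n + 1)) :=
    (c, fun v => if v = c then c else Fin.cases 0 id (U.2 v.succ)) with hTdef
  have hTc : T.2 c = c := by simp [hTdef]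
  have hTzero : ∀ v, v ≠ c → U.2 v.succ = 0 → T.2 v = 0 := fun v h1 h2 => by
    simp [hTdef, h1, h2]
  have hTsucc : ∀ v w, v ≠ c → U.2 v.succ = Fin.succ w → T.2 v = w := fun v w h1 h2 => by
    simp [hTdef, h1, h2]
  have hzero : Reaches T.2 0 c := by
    refine hc1.rec_head (P := fun x => Reaches U.2 x c.succ →
      ∀ v : Fin (n + 1), x = v.succ → Reaches T.2 v c) ?_ ?_ hc1 0 rfl
    · intro _ v hv
      rw [Fin.succ_injective _ hv]
      exact Reaches.refl _ _
    · rintro x hx ih hxc v rfl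
      have hnext := hxc.tail_of_ne hx
      by_cases hv : U.2 v.succ = 0
      · rw [hv] at hnext
        exact absurd (hnext.eq_of_fixed hU0) (Fin.succ_ne_zero c)
      · obtain ⟨w, hw⟩ := Fin.exists_succ_eq.2 hv
        refine (ih hnext w hw.symm).head_of_eq (hTsucc v w ?_ hw.symm)
        rintro rfl
        exact hx rfl
  have hT : IsRootedTree T := by
    refine ⟨hTc, fun v => ?_⟩
    change Reaches T.2 v c
    refine (hreach v.succ).rec_head (P := fun x => ∀ v : Fin (n + 1), x = v.succ → Reaches T.2 v c)
      (fun v hv => absurd hv.symm (Fin.succ_ne_zero v)) ?_ v rfl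
    rintro x - ih v rfl
    by_cases hvc : v = c
    · rw [hvc]
      exact Reaches.refl _ _
    · by_cases hv : U.2 v.succ = 0
      · exact hzero.head_of_eq (hTzero v hvc hv)
      · obtain ⟨w, hw⟩ := Fin.exists_succ_eq.2 hv
        exact (ih w hw.symm).head_of_eq (hTsucc v w hvc hw.symm)
  refine ⟨T, Finset.univ.filter fun v => v ≠ c ∧ U.2 v.succ = 0, hT, ?_, ?_⟩
  · intro v hv
    rw [Finset.mem_filter] at hv
    exact mem_minChildren.2 ⟨hv.2.1, hTzero v hv.2.1 hv.2.2⟩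
  · refine Prod.ext h0.symm (funext fun x => ?_)
    refine Fin.cases hU0.symm (fun v => ?_) x
    rw [cone_succ]
    by_cases hvc : v = c
    · rw [if_pos (Or.inl hvc), hvc, hc0]
    · by_cases hv : U.2 v.succ = 0
      · rw [if_pos (Or.inr (by simp [hvc, hv])), hv]
      · obtain ⟨w, hw⟩ := Fin.exists_succ_eq.2 hv
        rw [if_neg (by simp [hTdef, hvc, hv]), hTsucc v w hvc hw.symm, hw]

theorem minRootedSum_succ_succ {A : Type*} [CommRing A] (y z : A) (n m : ℕ) :
    minRootedSum y z (n + 1) (m + 1) =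
      ∑ j ∈ Finset.range (n + 1), tnkYZ y z n j * (j.choose m * z ^ (j - m)) := by
  have hpairs : ∑ p ∈ (rootedTrees (n + 1)).sigma fun T => (minChildren T).powersetCard m,
      (∏ j, edgeWeight y z p.1 j) * z ^ (childCount p.1 0 - m) =
      minRootedSum y z (n + 1) (m + 1) := by
    refine Finset.sum_bij (fun p _ => cone p.1 p.2) ?_ ?_ ?_ ?_
    · rintro ⟨T, S⟩ hp
      rw [Finset.mem_sigma, mem_rootedTrees, Finset.mem_powersetCard] at hp
      rw [Finset.mem_filter, mem_rootedTrees]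
      refine ⟨isRootedTree_cone hp.1, rfl, ?_⟩
      rw [childCount_cone hp.2.1, hp.2.2]
    · rintro ⟨T, S⟩ hp ⟨T', S'⟩ hp' h
      rw [Finset.mem_sigma, mem_rootedTrees, Finset.mem_powersetCard] at hp hp'
      obtain ⟨h1, h2⟩ := cone_injective hp.1 hp'.1 hp.2.1 hp'.2.1 h
      dsimp only at h1 h2
      rw [h1, h2]
    · intro U hU
      rw [Finset.mem_filter, mem_rootedTrees] at hU
      obtain ⟨T, S, hT, hS, rfl⟩ := exists_cone_eq hU.1 hU.2.1
      have hcard := hU.2.2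
      rw [childCount_cone hS] at hcard
      refine ⟨⟨T, S⟩, ?_, rfl⟩
      rw [Finset.mem_sigma, mem_rootedTrees, Finset.mem_powersetCard]
      exact ⟨hT, hS, Nat.succ_injective hcard⟩
    · rintro ⟨T, S⟩ hp
      rw [Finset.mem_sigma, mem_rootedTrees, Finset.mem_powersetCard] at hp
      dsimp only at hp ⊢
      rw [prod_edgeWeight_cone y z hp.1 hp.2.1, hp.2.2]
  rw [← hpairs, Finset.sum_sigma, ← Finset.sum_fiberwise_of_maps_to (t := Finset.range (n + 1))
    (g := fun T => childCount T 0)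
    fun T _ => Finset.mem_range.2 (Nat.lt_succ_iff.2 (childCount_le T))]
  refine Finset.sum_congr rfl fun j _ => ?_
  rw [tnkYZ_eq, Finset.sum_mul]
  refine Finset.sum_congr rfl fun T hT => ?_
  have hj := (Finset.mem_filter.1 hT).2
  dsimp only
  rw [Finset.sum_const, Finset.card_powersetCard, ← childCount_zero, hj, nsmul_eq_mul]
  ring

end Cone

section Main

theorem minorsMem_tnkYZ {R : Type*} [CommRing R] {S : Subsemiring R} {y z : R} (hy : y ∈ S)
    (hz : z ∈ S) (N : ℕ) : MinorsMem S N (tnkYZ y z) := by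
  induction N with
  | zero => exact minorsMem_zero
  | succ N ih =>
    have hF : MinorsMem S (N + 1) (minRootedSum y z) :=
      (ih.mul_pascal hz fun n j h => tnkYZ_eq_zero y z h).border (minRootedSum_zero_zero y z)
        (minRootedSum_zero_succ y z) (minRootedSum_succ_zero y z) (minRootedSum_succ_succ y z)
    exact hF.of_recurrence (w := fun j => (j + 1) * y)
      (fun j => S.mul_mem (S.add_mem (natCast_mem S j) S.one_mem) hy)
      (fun n j h => tnkYZ_eq_zero y z h) (tnkYZ_recurrence y z)

/-- The polynomials with nonnegative coefficients. -/
def coeffNonneg (σ : Type*) : Subsemiring (MvPolynomial σ ℤ) where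
  carrier := {p | ∀ m, 0 ≤ p.coeff m}
  zero_mem' m := by simp
  one_mem' m := by
    rw [MvPolynomial.coeff_one]
    split_ifs <;> simp
  add_mem' hp hq m := by
    rw [MvPolynomial.coeff_add]
    exact add_nonneg (hp m) (hq m)
  mul_mem' hp hq m := by
    rw [MvPolynomial.coeff_mul]
    exact Finset.sum_nonneg fun x _ => mul_nonneg (hp x.1) (hq x.2)

theorem X_mem_coeffNonneg {σ : Type*} (i : σ) : MvPolynomial.X i ∈ coeffNonneg σ := by
  intro m
  rw [MvPolynomial.coeff_X]
  split_ifs <;> simp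

end Main

end TreeMatrix

/-- the lower-triangular matrix `(t_{n,k}(y,z))_{n,k ≥ 0}` (with
`t_{n,k}(y,z) = 0` for `k > n`) over `ℤ[y,z]` is coefficientwise totally
positive: every minor is a polynomial in `y, z` with nonnegative
coefficients.  Here `y, z` are the variables `X 0, X 1` of
`MvPolynomial (Fin 2) ℤ`. -/
theorem tnkYZ_matrix_coefficientwise_totallyPositive :
    ∀ (k : ℕ) (rows cols : Fin k → ℕ), StrictMono rows → StrictMono cols →
      ∀ m : Fin 2 →₀ ℕ,
        0 ≤ MvPolynomial.coeff m
          ((Matrix.of fun a b =>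
            if cols b ≤ rows a then
              tnkYZ (MvPolynomial.X (R := ℤ) 0) (MvPolynomial.X 1) (rows a) (cols b)
            else 0).det) := by
  intro k rows cols hr hc
  have hmat : (Matrix.of fun a b => if cols b ≤ rows a then
      tnkYZ (MvPolynomial.X (R := ℤ) (0 : Fin 2)) (MvPolynomial.X 1) (rows a) (cols b) else 0) =
      Matrix.of fun a b =>
        tnkYZ (MvPolynomial.X (R := ℤ) (0 : Fin 2)) (MvPolynomial.X 1) (rows a) (cols b) := by
    ext1 a b
    simp only [Matrix.of_apply]
    split_ifs with h
    · rfl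
    · exact (TreeMatrix.tnkYZ_eq_zero _ _ (not_le.1 h)).symm
  rw [hmat]
  exact TreeMatrix.minorsMem_tnkYZ (TreeMatrix.X_mem_coeffNonneg 0)
    (TreeMatrix.X_mem_coeffNonneg 1) (∑ a, (rows a + 1)) k rows cols hr hc fun a =>
      Nat.lt_of_succ_le (Finset.single_le_sum (f := fun a => rows a + 1)
        (fun _ _ => Nat.zero_le _) (Finset.mem_univ a))
end

section
/- Let x and y be indeterminates. The weighted binomial matrix B_{x,y} with entries (B_{x,y})_{nk} = binom(n,k)·x^{n−k}·y^k for k ≤ n and 0 for k > n is totally positive in ℤ[x,y] equipped with the coefficientwise order: every minor of B_{x,y} is a polynomial in x and y all of whose coefficients are nonnegative integers. -/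
/-- The weighted binomial matrix `B_{x,y}` over `ℤ[x,y]` with entries
`C(n,k)·x^{n-k}·y^k` for `k ≤ n` and `0` for `k > n`; here `x, y` are the
variables `X 0, X 1` of `MvPolynomial (Fin 2) ℤ`. -/
noncomputable def weightedBinomialMatrix (n k : ℕ) : MvPolynomial (Fin 2) ℤ :=
  if k ≤ n then
    (n.choose k : MvPolynomial (Fin 2) ℤ) * MvPolynomial.X 0 ^ (n - k)
      * MvPolynomial.X 1 ^ k
  else 0

/-- Every minor of Pascal's triangle, written with the columns of the triangle as rows of the
matrix, is nonnegative. -/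
theorem det_choose_nonneg :
    ∀ (k : ℕ) (rows cols : Fin k → ℕ), StrictMono rows → StrictMono cols →
      0 ≤ (Matrix.of fun b a => ((rows a).choose (cols b) : ℤ)).det := by
  intro k
  induction k with
  | zero => intro rows cols _ _; simp
  | succ k ih =>
    suffices h : ∀ (n : ℕ) (rows cols : Fin (k + 1) → ℕ), rows 0 = n → StrictMono rows →
        StrictMono cols → 0 ≤ (Matrix.of fun b a => ((rows a).choose (cols b) : ℤ)).det from
      fun rows cols hr hc => h _ rows cols rfl hr hc
    intro n
    induction n with
    | zero =>
      intro rows cols h0 hr hc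
      rw [Matrix.det_succ_column_zero, Fin.sum_univ_succ]
      have hpos : ∀ i : Fin k, cols i.succ ≠ 0 := fun i =>
        (Nat.zero_le _ |>.trans_lt (hc (Fin.succ_pos i))).ne'
      have hz : ∀ i : Fin k, ((rows 0).choose (cols i.succ) : ℤ) = 0 := fun i => by
        rw [h0, Nat.choose_eq_zero_of_lt (Nat.pos_of_ne_zero (hpos i)), Nat.cast_zero]
      have hminor := ih (rows ∘ Fin.succ) (cols ∘ Fin.succ)
        (hr.comp (Fin.strictMono_succ)) (hc.comp (Fin.strictMono_succ))
      simp only [Matrix.of_apply, hz, mul_zero, zero_mul, Finset.sum_const_zero, add_zero,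
        Fin.val_zero, pow_zero, one_mul]
      exact mul_nonneg (Nat.cast_nonneg _) hminor
    | succ n ihn =>
      intro rows cols h0 hr hc
      have hrows : ∀ a, 0 < rows a := fun a => by
        have := hr.monotone (Fin.zero_le a)
        omega
      let u : Fin (k + 1) → Fin (k + 1) → ℤ := fun b a => ((rows a - 1).choose (cols b) : ℤ)
      let v : Fin (k + 1) → Fin (k + 1) → ℤ := fun b a =>
        if cols b = 0 then 0 else ((rows a - 1).choose (cols b - 1) : ℤ)
      have hsplit : (Matrix.of fun b a => ((rows a).choose (cols b) : ℤ)).det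
          = Matrix.detRowAlternating (u + v) := by
        change Matrix.det _ = Matrix.det _
        congr 1
        ext b a
        obtain ⟨q, hq⟩ := Nat.exists_eq_succ_of_ne_zero (hrows a).ne'
        rcases hb : cols b with _ | c
        · simp [u, v, hb]
        · simp [u, v, hb, hq, Nat.choose_succ_succ, add_comm]
      rw [hsplit]
      have hadd := (Matrix.detRowAlternating (n := Fin (k + 1))
        (R := ℤ)).toMultilinearMap.map_add_univ u v
      simp only [AlternatingMap.coe_multilinearMap] at hadd
      rw [hadd]
      refine Finset.sum_nonneg fun s _ => ?_
      change 0 ≤ (Matrix.of (s.piecewise u v)).det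
      by_cases hs : ∃ b, b ∉ s ∧ cols b = 0
      · obtain ⟨b, hbs, hb⟩ := hs
        rw [Matrix.det_eq_zero_of_row_eq_zero b]
        intro a
        simp [hbs, v, hb]
      · push Not at hs
        let c : Fin (k + 1) → ℕ := fun b => if b ∈ s then cols b else cols b - 1
        have hM : Matrix.of (s.piecewise u v) = Matrix.of fun b a => ((rows a - 1).choose (c b) : ℤ) := by
          ext b a
          by_cases hb : b ∈ s
          · simp [hb, u, c]
          · simp [hb, v, c, hs b hb]
        rw [hM]
        by_cases hinj : Function.Injective c
        · refine ihn (fun a => rows a - 1) c (by simp [h0]) (fun a a' h => ?_) ?_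
          · have := hr h
            have := hrows a
            change rows a - 1 < rows a' - 1
            omega
          · refine Monotone.strictMono_of_injective (fun b b' h => ?_) hinj
            rcases h.eq_or_lt with rfl | h
            · exact le_rfl
            · have := hc h
              simp only [c]
              split_ifs <;> omega
        · simp only [Function.Injective] at hinj
          push Not at hinj
          obtain ⟨b, b', hbb, hne⟩ := hinj
          rw [Matrix.det_zero_of_row_eq hne]
          ext a
          simp [hbb]

/-- Clearing the powers of `x` from a minor of the weighted binomial matrix. -/
theorem prod_X_pow_mul_det_weightedBinomialMatrix {k : ℕ} (rows cols : Fin k → ℕ) :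
    (∏ b, MvPolynomial.X 0 ^ cols b) *
        (Matrix.of fun a b => weightedBinomialMatrix (rows a) (cols b)).det =
      MvPolynomial.monomial
        (Finsupp.single 0 (∑ a, rows a) + Finsupp.single 1 (∑ b, cols b))
        (Matrix.of fun b a => ((rows a).choose (cols b) : ℤ)).det := by
  have hentry : ∀ n m : ℕ, MvPolynomial.X 0 ^ m * weightedBinomialMatrix n m =
      MvPolynomial.X 1 ^ m * (MvPolynomial.X 0 ^ n * MvPolynomial.C (n.choose m : ℤ)) := by
    intro n m
    unfold weightedBinomialMatrix
    split_ifs with h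
    · obtain ⟨d, rfl⟩ := Nat.exists_eq_add_of_le h
      simp only [Nat.add_sub_cancel_left, map_natCast]
      ring
    · simp [Nat.choose_eq_zero_of_lt (not_le.mp h)]
  rw [← Matrix.det_mul_row]
  simp only [Matrix.of_apply, hentry]
  have h1 := Matrix.det_mul_row (fun b => (MvPolynomial.X 1 : MvPolynomial (Fin 2) ℤ) ^ cols b)
    (Matrix.of fun a b => MvPolynomial.X 0 ^ rows a *
      MvPolynomial.C ((rows a).choose (cols b) : ℤ))
  have h2 := Matrix.det_mul_column (fun a => (MvPolynomial.X 0 : MvPolynomial (Fin 2) ℤ) ^ rows a)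
    (Matrix.of fun a b => MvPolynomial.C ((rows a).choose (cols b) : ℤ))
  have h3 : (Matrix.of fun a b =>
      (MvPolynomial.C ((rows a).choose (cols b) : ℤ) : MvPolynomial (Fin 2) ℤ)).det =
      MvPolynomial.C (Matrix.of fun b a => ((rows a).choose (cols b) : ℤ)).det := by
    rw [RingHom.map_det, ← Matrix.det_transpose]
    rfl
  simp only [Matrix.of_apply] at h1 h2
  rw [h1, h2, h3, Finset.prod_pow_eq_pow_sum, Finset.prod_pow_eq_pow_sum,
    MvPolynomial.X_pow_eq_monomial, MvPolynomial.X_pow_eq_monomial,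
    mul_comm (MvPolynomial.monomial _ _) (MvPolynomial.C _),
    MvPolynomial.C_mul_monomial, MvPolynomial.monomial_mul]
  simp [add_comm]

/-- the weighted binomial matrix `B_{x,y}` is totally positive
in `ℤ[x,y]` with the coefficientwise order: every minor is a polynomial in
`x` and `y` with nonnegative coefficients. -/
theorem weightedBinomialMatrix_coefficientwise_totallyPositive :
    ∀ (k : ℕ) (rows cols : Fin k → ℕ), StrictMono rows → StrictMono cols →
      ∀ m : Fin 2 →₀ ℕ,
        0 ≤ MvPolynomial.coeff m
          ((Matrix.of fun a b =>
            weightedBinomialMatrix (rows a) (cols b)).det) := by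
  intro k rows cols hr hc m
  have h := congrArg (MvPolynomial.coeff (Finsupp.single 0 (∑ b, cols b) + m))
    (prod_X_pow_mul_det_weightedBinomialMatrix rows cols)
  rw [Finset.prod_pow_eq_pow_sum, MvPolynomial.X_pow_eq_monomial,
    MvPolynomial.coeff_monomial_mul, one_mul, MvPolynomial.coeff_monomial] at h
  rw [h]
  split_ifs
  · exact det_choose_nonneg k rows cols hr hc
  · exact le_rfl
end
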